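/- There exists a constant C > 0 such that for every integer N ≥ 2 and every real R with C ≤ R ≤ N/(log N)^{1/2}, the spherical ensemble with N particles satisfies 𝐏_N( wce(x_N; 2) ≤ R (log N)^{1/2} / N ) ≥ 1 − N^{−R²/C}. -/

import Mathlib

open MeasureTheory Real Metric
open scoped ENNReal RealInnerProductSpace Manifold

noncomputable section

/-- Euclidean 3-space. -/
abbrev E3 : Type := EuclideanSpace ℝ (Fin 3)

/-- The unit two-sphere in `ℝ³`. -/
abbrev S2 : Type := Metric.sphere (0 : E3) 1

instance : Fact (Module.finrank ℝ E3 = 2 + 1) := ⟨finrank_euclideanSpace_fin⟩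

/-- The Riemannian area measure `dV_g` on the unit two-sphere (total mass `4π`). -/
abbrev sphereArea : Measure S2 := (volume : Measure E3).toSphere

/-- The uniform probability measure `σ = dV_g / (4π)` on the unit two-sphere. -/
def sphereUniform : Measure S2 := (ENNReal.ofReal (4 * π))⁻¹ • sphereArea

instance : IsFiniteMeasure sphereUniform := by
  constructor
  rw [sphereUniform, Measure.smul_apply, smul_eq_mul]
  exact ENNReal.mul_lt_top (by simp [Real.pi_pos]) (measure_lt_top _ _)

/-- The density (up to normalization) of the spherical ensemble:
`∏_{i ≠ j} |x_i − x_j| = ∏_{i < j} |x_i − x_j|²`. -/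
def ensembleDensity (N : ℕ) (x : Fin N → S2) : ℝ≥0∞ :=
  ENNReal.ofReal (∏ p ∈ Finset.univ.offDiag, dist (x p.1) (x p.2))

/-- The spherical ensemble with `N` particles: the probability measure on `(S²)^N`
with density proportional to `∏_{i<j} |x_i − x_j|²` with respect to `σ^{⊗N}`. -/
def sphericalEnsemble (N : ℕ) : Measure (Fin N → S2) :=
  (∫⁻ x, ensembleDensity N x ∂(Measure.pi fun _ : Fin N => sphereUniform))⁻¹ •
    (Measure.pi fun _ : Fin N => sphereUniform).withDensity (ensembleDensity N)

/-- The Legendre polynomial of degree `l` (Rodrigues' formula). -/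
def legendreP (l : ℕ) : Polynomial ℝ :=
  Polynomial.C ((2 ^ l * l.factorial : ℝ)⁻¹) *
    (Polynomial.derivative^[l] ((Polynomial.X ^ 2 - 1) ^ l))

/-- The degree-`l` zonal harmonic kernel `Z_l(x,y) = ((2l+1)/(4π)) P_l(⟨x,y⟩)`, which is the
reproducing kernel of the eigenspace of the Laplace–Beltrami operator with eigenvalue `l(l+1)`,
inside `L²(X, dV_g)`. -/
def zonal (l : ℕ) (x y : S2) : ℝ :=
  ((2 * l + 1 : ℝ) / (4 * π)) * (legendreP l).eval ⟪(x : E3), (y : E3)⟫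

/-- `∫∫ f(x) Z_l(x,y) f(y) dV_g(x) dV_g(y)`, the squared `L²(dV_g)`-norm of the projection
of `f` onto the degree-`l` eigenspace of the Laplace–Beltrami operator. -/
def levelSq (l : ℕ) (f : S2 → ℝ) : ℝ :=
  ∫ x, ∫ y, f x * zonal l x y * f y ∂sphereArea ∂sphereArea

/-- The squared Sobolev norm `‖f‖²_{H^s(X)} = ∫_X f (Δ_g)^s f dV_g`, expressed spectrally:
`Σ_{l≥1} (l(l+1))^s ‖proj_l f‖²_{L²(dV_g)}`, where `l(l+1)` are the positive eigenvalues of the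
(positive) Laplace–Beltrami operator `Δ_g` on the unit two-sphere. -/
def sobNormSq (s : ℝ) (f : S2 → ℝ) : ℝ :=
  ∑' l : ℕ, (((l + 1) * (l + 2) : ℕ) : ℝ) ^ s * levelSq (l + 1) f

/-- Smooth real-valued functions on the two-sphere. -/
def SmoothOnSphere (f : S2 → ℝ) : Prop :=
  ContMDiff (𝓡 2) 𝓘(ℝ, ℝ) (⊤ : ℕ∞) f

/-- The worst-case error `wce(x_N; s)` of the numerical integration rule with node set
`x_N = (x_1, …, x_N)` and smoothness parameter `s`. -/
def wce (N : ℕ) (s : ℝ) (x : Fin N → S2) : ℝ :=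
  sSup { r | ∃ f : S2 → ℝ, SmoothOnSphere f ∧ sobNormSq s f ≤ 1 ∧
    r = |(∫ y, f y ∂sphereUniform) - (1 / N : ℝ) * ∑ i, f (x i)| }

end


section
open MeasureTheory Real Metric
open scoped ENNReal RealInnerProductSpace Manifold

noncomputable section

/-- action of a linear isometry on the sphere -/
def rotS (g : E3 ≃ₗᵢ[ℝ] E3) (x : S2) : S2 := ⟨g x, by simp⟩

@[simp] lemma rotS_coe (g : E3 ≃ₗᵢ[ℝ] E3) (x : S2) : ((rotS g x : S2) : E3) = g x := rfl

lemma continuous_rotS (g : E3 ≃ₗᵢ[ℝ] E3) : Continuous (rotS g) := by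
  unfold rotS
  exact Continuous.subtype_mk (g.continuous.comp continuous_subtype_val) _

open scoped Pointwise in
lemma mp_rotS_area (g : E3 ≃ₗᵢ[ℝ] E3) : MeasurePreserving (rotS g) sphereArea sphereArea := by
  refine ⟨(continuous_rotS g).measurable, ?_⟩
  ext s hs
  rw [Measure.map_apply (continuous_rotS g).measurable hs,
    Measure.toSphere_apply' _ hs, Measure.toSphere_apply' _ ((continuous_rotS g).measurable hs)]
  congr 1
  have : (Set.Ioo (0:ℝ) 1 • ((fun x : S2 => (x : E3)) '' (rotS g ⁻¹' s)))
      = g ⁻¹' (Set.Ioo (0:ℝ) 1 • ((fun x : S2 => (x : E3)) '' s)) := by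
    ext z
    simp only [Set.mem_smul, Set.mem_image, Set.mem_preimage]
    constructor
    · rintro ⟨r, hr, _, ⟨x, hx, rfl⟩, rfl⟩
      exact ⟨r, hr, _, ⟨_, hx, rfl⟩, by simp⟩
    · rintro ⟨r, hr, _, ⟨x, hx, rfl⟩, h⟩
      refine ⟨r, hr, _, ⟨rotS g.symm x, ?_, rfl⟩, ?_⟩
      · have : rotS g (rotS g.symm x) = x := by ext1; simp
        rw [this]; exact hx
      · apply g.injective
        rw [← h]; simp
  rw [this]
  exact g.measurePreserving.measure_preimage_equiv (f := g.toMeasurableEquiv) _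

lemma mp_rotS (g : E3 ≃ₗᵢ[ℝ] E3) : MeasurePreserving (rotS g) sphereUniform sphereUniform := by
  unfold sphereUniform
  exact (mp_rotS_area g).smul_measure _

lemma area_univ : sphereArea Set.univ = ENNReal.ofReal (4 * π) := by
  rw [Measure.toSphere_apply_univ, EuclideanSpace.volume_ball_fin_three, finrank_euclideanSpace_fin]
  rw [ENNReal.ofReal_one, one_pow, one_mul,
    ← ENNReal.ofReal_natCast, ← ENNReal.ofReal_mul (by positivity)]
  congr 1; push_cast; ring

instance : IsProbabilityMeasure sphereUniform := by
  constructor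
  rw [sphereUniform, Measure.smul_apply, smul_eq_mul, area_univ]
  exact ENNReal.inv_mul_cancel (by simp [Real.pi_pos]) ENNReal.ofReal_ne_top

lemma integral_area {E : Type*} [NormedAddCommGroup E] [NormedSpace ℝ E] (f : S2 → E) :
    ∫ x, f x ∂sphereArea = (4 * π) • ∫ x, f x ∂sphereUniform := by
  unfold sphereUniform
  rw [integral_smul_measure, ENNReal.toReal_inv, ENNReal.toReal_ofReal (by positivity), smul_smul,
    mul_inv_cancel₀ (by positivity), one_smul]

lemma integrable_sph {E : Type*} [NormedAddCommGroup E] {f : S2 → E} (hf : Continuous f) :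
    Integrable f sphereUniform :=
  hf.integrable_of_hasCompactSupport (HasCompactSupport.of_compactSpace f)

lemma integral_rotS {E : Type*} [NormedAddCommGroup E] [NormedSpace ℝ E] (g : E3 ≃ₗᵢ[ℝ] E3)
    {f : S2 → E} (hf : AEStronglyMeasurable f sphereUniform) :
    ∫ x, f (rotS g x) ∂sphereUniform = ∫ x, f x ∂sphereUniform := by
  have h := (mp_rotS g).map_eq
  conv_rhs => rw [← h]
  rw [integral_map (mp_rotS g).aemeasurable (by rw [h]; exact hf)]

lemma exists_rot (y z : S2) : ∃ g : E3 ≃ₗᵢ[ℝ] E3, rotS g y = z := by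
  have : ‖(y : E3)‖ = ‖(z : E3)‖ := by simp
  exact ⟨_, Subtype.ext (Submodule.reflection_sub this)⟩

/-- north pole -/
def pole : S2 := ⟨EuclideanSpace.single 2 1, by simp⟩

@[simp] lemma inner_pole (x : S2) : ⟪(pole : E3), (x : E3)⟫ = (x : E3) 2 := by
  rw [pole, EuclideanSpace.inner_single_left]; simp

lemma sph_sq (x : S2) : (x : E3) 0 ^ 2 + (x : E3) 1 ^ 2 + (x : E3) 2 ^ 2 = 1 := by
  have h : ‖(x : E3)‖ = 1 := by simp
  rw [EuclideanSpace.norm_eq, Real.sqrt_eq_one] at h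
  simpa [Fin.sum_univ_three] using h

lemma gauss_moment (n : ℕ) : ∫ x in Set.Ioi (0:ℝ), x ^ (2 * n) * rexp (-x ^ 2) =
    Real.Gamma (n + 1 / 2) / 2 := by
  have := integral_rpow_mul_exp_neg_rpow (p := 2) (q := 2 * n) (by norm_num) (by linarith [(Nat.cast_nonneg n : (0:ℝ) ≤ n)])
  rw [show ((2 * n + 1) / 2 : ℝ) = n + 1 / 2 by ring] at this
  rw [show Real.Gamma (n + 1 / 2) / 2 = 1 / 2 * Real.Gamma (n + 1 / 2) by ring, ← this]
  refine setIntegral_congr_fun measurableSet_Ioi fun x hx => ?_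
  rw [Real.rpow_two]
  congr 1
  rw [show (2 * n : ℝ) = ((2 * n : ℕ) : ℝ) by push_cast; ring, Real.rpow_natCast]

lemma gauss_moment_full (n : ℕ) : ∫ x : ℝ, x ^ (2 * n) * rexp (-x ^ 2) = Real.Gamma (n + 1 / 2) := by
  have := integral_comp_abs (f := fun x => x ^ (2 * n) * rexp (-x ^ 2))
  simp only [pow_mul, sq_abs] at this
  simp only [pow_mul]
  rw [this]
  simp only [← pow_mul]
  rw [gauss_moment]; ring

lemma gauss_moment_E3 (n : ℕ) : ∫ x : E3, (x 2) ^ (2 * n) * rexp (-‖x‖ ^ 2) =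
    π * Real.Gamma (n + 1 / 2) := by
  rw [← (EuclideanSpace.volume_preserving_symm_measurableEquiv_toLp (Fin 3)).symm.integral_comp
    (MeasurableEquiv.measurableEmbedding _)]
  have : ∀ y : Fin 3 → ℝ, ((MeasurableEquiv.toLp 2 (Fin 3 → ℝ)).symm.symm y) 2 ^ (2 * n) *
      rexp (-‖(MeasurableEquiv.toLp 2 (Fin 3 → ℝ)).symm.symm y‖ ^ 2)
      = ∏ i, ((![fun x => x ^ (2*0) * rexp (- x ^ 2), fun x => x ^ (2*0) *rexp (- x ^ 2), fun x => x ^ (2 * n) * rexp (-x ^ 2)] : Fin 3 → ℝ → ℝ) i (y i)) := by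
    intro y
    simp only [Fin.prod_univ_three, EuclideanSpace.norm_sq_eq, Fin.sum_univ_three]
    simp [Real.exp_add]
    ring
  simp_rw [this]
  rw [volume_pi, integral_fintype_prod_eq_prod]
  simp only [Fin.prod_univ_three]
  have g0 : Real.Gamma ((0:ℕ) + 1 / 2) = √π := by
    rw [← Real.Gamma_one_half_eq]; norm_num
  simp only [Matrix.cons_val_zero, Matrix.cons_val_one, Matrix.cons_val]
  rw [gauss_moment_full, gauss_moment_full, g0, Real.mul_self_sqrt Real.pi_pos.le]

lemma moment_polar (n : ℕ) : ∫ x : E3, (x 2) ^ (2 * n) * rexp (-‖x‖ ^ 2) =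
    (∫ x : S2, (x : E3) 2 ^ (2 * n) ∂sphereArea) *
      ∫ r in Set.Ioi (0:ℝ), r ^ (2 * (n + 1)) * rexp (-r ^ 2) := by
  have h1 : ∫ x : E3, (x 2) ^ (2 * n) * rexp (-‖x‖ ^ 2) =
      ∫ x : ({(0)}ᶜ : Set E3), ((x.1 2) ^ (2 * n) * rexp (-‖x.1‖ ^ 2)) ∂((volume : Measure E3).comap Subtype.val) := by
    rw [integral_subtype_comap (measurableSet_singleton _).compl
      fun x : E3 ↦ ((x 2) ^ (2 * n) * rexp (-‖x‖ ^ 2)), restrict_compl_singleton]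
  have h2 := (volume : Measure E3).measurePreserving_homeomorphUnitSphereProd.integral_comp
    (Homeomorph.measurableEmbedding _)
    (fun p : S2 × Set.Ioi (0:ℝ) => ((p.1 : E3) 2 ^ (2*n)) * ((p.2 : ℝ) ^ (2 * n) * rexp (-(p.2:ℝ) ^ 2)))
  rw [h1]
  rw [integral_prod_mul (μ := (volume : Measure E3).toSphere)
    (ν := Measure.volumeIoiPow (Module.finrank ℝ E3 - 1))
    (fun x : S2 => (x : E3) 2 ^ (2*n))
    (fun r : Set.Ioi (0:ℝ) => ((r : ℝ) ^ (2 * n) * rexp (-(r:ℝ) ^ 2)))] at h2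
  have h3 : ∫ r : Set.Ioi (0:ℝ), ((r : ℝ) ^ (2 * n) * rexp (-(r:ℝ) ^ 2)) ∂(Measure.volumeIoiPow (Module.finrank ℝ E3 - 1))
      = ∫ r in Set.Ioi (0:ℝ), r ^ (2 * (n + 1)) * rexp (-r ^ 2) := by
    simp only [Measure.volumeIoiPow, ENNReal.ofReal]
    rw [integral_withDensity_eq_integral_smul]
    · rw [integral_subtype_comap measurableSet_Ioi fun a ↦ Real.toNNReal (a ^ (Module.finrank ℝ E3 - 1)) • ((a : ℝ) ^ (2 * n) * rexp (-(a:ℝ) ^ 2))]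
      refine setIntegral_congr_fun measurableSet_Ioi fun x hx ↦ ?_
      simp only [finrank_euclideanSpace_fin]
      rw [NNReal.smul_def, Real.coe_toNNReal _ (pow_nonneg (le_of_lt hx) _), smul_eq_mul]
      ring
    · exact (measurable_subtype_coe.pow_const _).real_toNNReal
  rw [← h3, ← h2]
  congr 1
  ext x
  have hx : ‖x.1‖ ≠ 0 := norm_ne_zero_iff.2 x.2
  simp only [homeomorphUnitSphereProd_apply_fst_coe, homeomorphUnitSphereProd_apply_snd_coe]
  simp only [PiLp.smul_apply, smul_eq_mul, mul_pow]
  have h4 : (‖x.1‖⁻¹) ^ (2 * n) * ‖x.1‖ ^ (2 * n) = 1 := by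
    rw [← mul_pow, inv_mul_cancel₀ hx, one_pow]
  linear_combination (-(x.1 2 ^ (2 * n)) * rexp (-‖x.1‖ ^ 2)) * h4

lemma moment_even (n : ℕ) : ∫ x : S2, (x : E3) 2 ^ (2 * n) ∂sphereUniform = 1 / (2 * n + 1) := by
  have h := moment_polar n
  rw [gauss_moment_E3, gauss_moment, integral_area, smul_eq_mul] at h
  push_cast at h
  rw [show (n + 1 + 1 / 2 : ℝ) = (n + 1/2) + 1 by ring, Real.Gamma_add_one (by positivity)] at h
  have hG : Real.Gamma (n + 1/2) ≠ 0 := (Real.Gamma_pos_of_pos (by positivity)).ne'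
  rw [eq_div_iff (by positivity)]
  have hpi := Real.pi_pos.ne'
  apply mul_left_cancel₀ (mul_ne_zero hpi hG)
  linear_combination -h

lemma moment_odd (n : ℕ) : ∫ x : S2, (x : E3) 2 ^ (2 * n + 1) ∂sphereUniform = 0 := by
  have := integral_rotS (LinearIsometryEquiv.neg ℝ (E := E3)) (f := fun x : S2 => (x : E3) 2 ^ (2 * n + 1))
    (by fun_prop)
  simp only [rotS_coe, LinearIsometryEquiv.coe_neg, PiLp.neg_apply] at this
  have h2 : ∀ a : ℝ, (-a) ^ (2 * n + 1) = - a ^ (2 * n + 1) := fun a => Odd.neg_pow ⟨n, rfl⟩ a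
  simp only [h2, integral_neg] at this
  linarith

lemma moment (n : ℕ) : ∫ x : S2, (x : E3) 2 ^ n ∂sphereUniform = (1 / 2) * ∫ t in (-1:ℝ)..1, t ^ n := by
  rw [integral_pow]
  rcases Nat.even_or_odd' n with ⟨k, rfl | rfl⟩
  · rw [moment_even, Odd.neg_pow ⟨k, rfl⟩]; push_cast; simp; field_simp; norm_num
  · rw [moment_odd, Even.neg_pow ⟨k + 1, by ring⟩]; simp

lemma law_poly (p : Polynomial ℝ) : ∫ x : S2, p.eval ((x : E3) 2) ∂sphereUniform =
    (1 / 2) * ∫ t in (-1:ℝ)..1, p.eval t := by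
  simp only [Polynomial.eval_eq_sum_range]
  rw [integral_finsetSum _ (fun i _ => integrable_sph (by fun_prop)),
    intervalIntegral.integral_finsetSum (fun i _ => (Continuous.intervalIntegrable (by fun_prop) _ _)), Finset.mul_sum]
  refine Finset.sum_congr rfl fun i _ => ?_
  rw [integral_const_mul, intervalIntegral.integral_const_mul, moment]; ring

lemma coord_mem (x : S2) : (x : E3) 2 ∈ Set.Icc (-1:ℝ) 1 := by
  have := sph_sq x
  constructor <;> nlinarith [sq_nonneg ((x : E3) 0), sq_nonneg ((x : E3) 1)]

lemma law_cont {g : ℝ → ℝ} (hg : Continuous g) : ∫ x : S2, g ((x : E3) 2) ∂sphereUniform =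
    (1 / 2) * ∫ t in (-1:ℝ)..1, g t := by
  apply eq_of_abs_sub_le_all
  intro ε hε
  obtain ⟨p, hp⟩ := exists_polynomial_near_of_continuousOn (-1) 1 g hg.continuousOn (ε/2) (by positivity)
  have hl := law_poly p
  have h1 : |∫ x : S2, (p.eval ((x : E3) 2) - g ((x : E3) 2)) ∂sphereUniform| ≤ ε / 2 := by
    have := norm_integral_le_of_norm_le_const (μ := sphereUniform) (C := ε/2)
      (f := fun x : S2 => p.eval ((x : E3) 2) - g ((x : E3) 2))
      (Filter.Eventually.of_forall fun x => (hp _ (coord_mem x)).le)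
    simpa using this
  have h2 : |∫ t in (-1:ℝ)..1, (p.eval t - g t)| ≤ ε := by
    have := intervalIntegral.norm_integral_le_of_norm_le_const (a := -1) (b := 1) (C := ε/2)
      (f := fun t : ℝ => p.eval t - g t) (fun t ht => by
        rw [Set.uIoc_of_le (by norm_num)] at ht
        exact (hp _ ⟨ht.1.le, ht.2⟩).le)
    rw [Real.norm_eq_abs] at this
    refine this.trans (le_of_eq ?_)
    norm_num
  rw [integral_sub (integrable_sph (by fun_prop)) (integrable_sph (by fun_prop))] at h1
  rw [intervalIntegral.integral_sub (Continuous.intervalIntegrable (by fun_prop) _ _)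
    (Continuous.intervalIntegrable (by fun_prop) _ _)] at h2
  rw [abs_le] at *
  constructor <;> linarith

lemma law_cont' {g : ℝ → ℝ} (hg : Continuous g) (y : S2) :
    ∫ x : S2, g ⟪(y : E3), (x : E3)⟫ ∂sphereUniform = (1 / 2) * ∫ t in (-1:ℝ)..1, g t := by
  obtain ⟨G, hG⟩ := exists_rot y pole
  rw [← law_cont hg, ← integral_rotS G (f := fun x : S2 => g ((x : E3) 2)) (by fun_prop)]
  congr 1; ext x
  rw [← inner_pole, ← hG]; simp

end
end

section
open MeasureTheory Real Set Filter Topology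

noncomputable section

/-- monotone transport on the unit interval -/
lemma exists_transport {F G f g : ℝ → ℝ} (hF : ∀ x, HasDerivAt F (f x) x)
    (hG : ∀ x, HasDerivAt G (g x) x) (hf : ∀ x ∈ Ioo (0:ℝ) 1, 0 < f x)
    (hg : ∀ x ∈ Ioo (0:ℝ) 1, 0 < g x) (F0 : F 0 = 0) (F1 : F 1 = 1) (G0 : G 0 = 0) (G1 : G 1 = 1) :
    ∃ T : ℝ → ℝ, Continuous T ∧ (∀ x ∈ Ioo (0:ℝ) 1, T x ∈ Ioo (0:ℝ) 1) ∧
      (∀ x ∈ Icc (0:ℝ) 1, G (T x) = F x) ∧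
      (∀ x ∈ Ioo (0:ℝ) 1, HasDerivAt T (f x / g (T x)) x) := by
  have hFc : Continuous F := continuous_iff_continuousAt.2 fun x => (hF x).continuousAt
  have hGc : Continuous G := continuous_iff_continuousAt.2 fun x => (hG x).continuousAt
  have mono : ∀ {F f : ℝ → ℝ}, Continuous F → (∀ x, HasDerivAt F (f x) x) →
      (∀ x ∈ Ioo (0:ℝ) 1, 0 < f x) → StrictMonoOn F (Icc 0 1) := by
    intro F f hc hF hf
    refine strictMonoOn_of_deriv_pos (convex_Icc 0 1) hc.continuousOn fun x hx => ?_
    rw [interior_Icc] at hx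
    rw [(hF x).deriv]; exact hf x hx
  have hFm := mono hFc hF hf
  have hGm := mono hGc hG hg
  have h01 : (0:ℝ) ≤ 1 := zero_le_one
  have z0 : (0:ℝ) ∈ Icc (0:ℝ) 1 := ⟨le_rfl, h01⟩
  have z1 : (1:ℝ) ∈ Icc (0:ℝ) 1 := ⟨h01, le_rfl⟩
  have hGI : ∀ x ∈ Icc (0:ℝ) 1, G x ∈ Icc (0:ℝ) 1 := fun x hx =>
    ⟨by rw [← G0]; exact hGm.monotoneOn z0 hx hx.1, by rw [← G1]; exact hGm.monotoneOn hx z1 hx.2⟩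
  have hFI : ∀ x ∈ Icc (0:ℝ) 1, F x ∈ Icc (0:ℝ) 1 := fun x hx =>
    ⟨by rw [← F0]; exact hFm.monotoneOn z0 hx hx.1, by rw [← F1]; exact hFm.monotoneOn hx z1 hx.2⟩
  have hFI' : ∀ x ∈ Ioo (0:ℝ) 1, F x ∈ Ioo (0:ℝ) 1 := fun x hx =>
    ⟨by rw [← F0]; exact hFm z0 ⟨hx.1.le, hx.2.le⟩ hx.1,
     by rw [← F1]; exact hFm ⟨hx.1.le, hx.2.le⟩ z1 hx.2⟩
  let e0 : Icc (0:ℝ) 1 → Icc (0:ℝ) 1 := fun x => ⟨G x, hGI x x.2⟩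
  have e0m : StrictMono e0 := fun x y hxy => hGm x.2 y.2 hxy
  have e0s : Function.Surjective e0 := by
    rintro ⟨y, hy⟩
    have := intermediate_value_Icc h01 hGc.continuousOn
    rw [G0, G1] at this
    obtain ⟨x, hx, hxy⟩ := this hy
    exact ⟨⟨x, hx⟩, Subtype.ext hxy⟩
  let e := StrictMono.orderIsoOfSurjective e0 e0m e0s
  let S : ℝ → ℝ := fun y => (e.symm (projIcc 0 1 h01 y) : ℝ)
  have hS : Continuous S := continuous_subtype_val.comp (e.symm.continuous.comp continuous_projIcc)
  have hGS : ∀ y ∈ Icc (0:ℝ) 1, G (S y) = y := by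
    intro y hy
    have : e (e.symm (projIcc 0 1 h01 y)) = projIcc 0 1 h01 y := e.apply_symm_apply _
    rw [projIcc_of_mem h01 hy] at this
    have h2 := congrArg Subtype.val this
    simp only [S, projIcc_of_mem h01 hy]
    exact h2
  have hSI : ∀ y, S y ∈ Icc (0:ℝ) 1 := fun y => (e.symm (projIcc 0 1 h01 y)).2
  have hT : ∀ x ∈ Ioo (0:ℝ) 1, S (F x) ∈ Ioo (0:ℝ) 1 := by
    intro x hx
    have h1 := hGS _ (hFI x ⟨hx.1.le, hx.2.le⟩)
    have h2 := hFI' x hx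
    refine ⟨lt_of_le_of_ne (hSI _).1 ?_, lt_of_le_of_ne (hSI _).2 ?_⟩
    · intro h; rw [← h, G0] at h1; linarith [h2.1]
    · intro h; rw [h, G1] at h1; linarith [h2.2]
  refine ⟨fun x => S (F x), hS.comp hFc, hT, fun x hx => hGS _ (hFI x hx), ?_⟩
  intro x hx
  have h1 : HasDerivAt S (g (S (F x)))⁻¹ (F x) := by
    refine HasDerivAt.of_local_left_inverse hS.continuousAt (hG _) (hg _ (hT x hx)).ne' ?_
    filter_upwards [Icc_mem_nhds (hFI' x hx).1 (hFI' x hx).2] with y hy using hGS y hy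
  have := h1.comp x (hF x)
  convert! this using 1
  rw [div_eq_mul_inv, mul_comm]

/-- unnormalised beta weight -/
def bw (a b : ℕ) (x : ℝ) : ℝ := x ^ a * (1 - x) ^ b

lemma bw_cont (a b : ℕ) : Continuous (bw a b) := by unfold bw; fun_prop

lemma bw_pos (a b : ℕ) {x : ℝ} (hx : x ∈ Ioo (0:ℝ) 1) : 0 < bw a b x := by
  have h1 := hx.1
  have h2 : 0 < 1 - x := by linarith [hx.2]
  unfold bw; positivity

lemma bw_nonneg (a b : ℕ) {x : ℝ} (hx : x ∈ Icc (0:ℝ) 1) : 0 ≤ bw a b x := by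
  have h1 := hx.1
  have h2 : 0 ≤ 1 - x := by linarith [hx.2]
  unfold bw; positivity

lemma bw_int_pos (a b : ℕ) {e : ℝ → ℝ} (he : Continuous e) (hpos : ∀ x, 0 < e x) :
    0 < ∫ x in (0:ℝ)..1, e x * bw a b x := by
  refine intervalIntegral.intervalIntegral_pos_of_pos_on
    ((he.mul (bw_cont a b)).intervalIntegrable _ _) (fun x hx => mul_pos (hpos x) (bw_pos a b hx)) zero_lt_one

lemma bw_upper (a b : ℕ) {e : ℝ → ℝ} (he : Continuous e) (he0 : ∀ x, 0 < e x) {H : ℝ}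
    (hH : ∀ x ∈ Icc (0:ℝ) 1, e x ≤ H) {T : ℝ} (hT : T ∈ Icc (0:ℝ) 1) :
    ∫ x in (0:ℝ)..T, e x * bw a b x ≤ H * T ^ (a + 1) := by
  have : ∫ x in (0:ℝ)..T, e x * bw a b x ≤ ∫ x in (0:ℝ)..T, H * T ^ a := by
    refine intervalIntegral.integral_mono_on hT.1 ((he.mul (bw_cont a b)).intervalIntegrable _ _)
      (by simp) fun x hx => ?_
    have hx1 : x ∈ Icc (0:ℝ) 1 := ⟨hx.1, hx.2.trans hT.2⟩
    have : bw a b x ≤ T ^ a := by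
      unfold bw
      have h1 : x ^ a ≤ T ^ a := pow_le_pow_left₀ hx.1 hx.2 a
      have h2 : (1 - x) ^ b ≤ 1 := pow_le_one₀ (by linarith [hx1.2]) (by linarith [hx1.1])
      have h3 : 0 ≤ T ^ a := pow_nonneg hT.1 a
      nlinarith [pow_nonneg hx.1 a]
    exact mul_le_mul (hH x hx1) this (bw_nonneg a b hx1) ((he0 x).le.trans (hH x hx1))
  refine this.trans (le_of_eq ?_)
  rw [intervalIntegral.integral_const, smul_eq_mul]; ring

lemma bw_lower (a b : ℕ) {x : ℝ} (hx : x ∈ Icc (0:ℝ) 1) :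
    x ^ (a + 1) * ∫ v in (0:ℝ)..1, bw a b v ≤ ∫ u in (0:ℝ)..x, bw a b u := by
  have h := intervalIntegral.mul_integral_comp_mul_left (a := 0) (b := 1) (f := bw a b) (c := x)
  rw [mul_zero, mul_one] at h
  rw [← h, pow_succ, mul_comm (x ^ a) x, mul_assoc]
  refine mul_le_mul_of_nonneg_left ?_ hx.1
  rw [← intervalIntegral.integral_const_mul]
  refine intervalIntegral.integral_mono_on zero_le_one
    ((continuous_const.mul (bw_cont a b)).intervalIntegrable _ _)
    (((bw_cont a b).comp (continuous_const.mul continuous_id)).intervalIntegrable _ _) fun v hv => ?_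
  unfold bw
  rw [mul_pow, mul_assoc]
  have : (1 - v) ^ b ≤ (1 - x * v) ^ b :=
    pow_le_pow_left₀ (by linarith [hv.2]) (by nlinarith [hv.1, hx.2]) b
  have h1 := pow_nonneg hx.1 a
  have h2 := pow_nonneg hv.1 a
  gcongr

lemma bw_reflect (a b : ℕ) (e : ℝ → ℝ) (x : ℝ) :
    ∫ u in x..1, e u * bw a b u = ∫ u in (0:ℝ)..(1 - x), e (1 - u) * bw b a u := by
  have := intervalIntegral.integral_comp_sub_left (a := 0) (b := 1 - x) (fun u => e u * bw a b u) 1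
  simp only [sub_sub_cancel, sub_zero] at this
  rw [← this]
  refine intervalIntegral.integral_congr fun u _ => ?_
  simp only [bw, sub_sub_cancel]; ring

lemma log_lower {a : ℕ} {K x T : ℝ} (hx : 0 < x) (hT : 0 < T) (hK : 0 < K) (hT1 : T ≤ 1)
    (h : x ^ (a + 1) ≤ K * T ^ (a + 1)) : |log T| ≤ |log x| + |log K| := by
  have h1 := Real.log_le_log (by positivity) h
  rw [Real.log_mul hK.ne' (by positivity), Real.log_pow, Real.log_pow] at h1
  have h2 : log T ≤ 0 := Real.log_nonpos hT.le hT1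
  rw [abs_of_nonpos h2]
  push_cast at h1
  have h3 : -log x ≤ |log x| := neg_le_abs _
  have h4 : log K ≤ |log K| := le_abs_self _
  have h5 : (0:ℝ) ≤ a := Nat.cast_nonneg a
  have h6 := abs_nonneg (log K)
  have h7 : (a + 1) * (-log T) ≤ (a + 1) * (- log x + |log K|) := by nlinarith
  have := le_of_mul_le_mul_left h7 (by positivity)
  linarith

/-- relative entropy between Bernoulli laws -/
def kl2 (x y : ℝ) : ℝ := x * (log x - log y) + (1 - x) * (log (1 - x) - log (1 - y))

theorem transport_entropy (a b : ℕ) {h g : ℝ → ℝ} (hh : Continuous h)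
    (hgi : IntervalIntegrable (fun x => bw a b x * g x) volume 0 1)
    (hyp : ∀ x ∈ Ioo (0:ℝ) 1, ∀ y ∈ Ioo (0:ℝ) 1, h y ≤ g x + (a + b + 2) * kl2 x y) :
    log ((∫ x in (0:ℝ)..1, rexp (h x) * bw a b x) / ∫ x in (0:ℝ)..1, bw a b x) *
      (∫ x in (0:ℝ)..1, bw a b x) ≤ ∫ x in (0:ℝ)..1, bw a b x * g x := by
  set Z := ∫ x in (0:ℝ)..1, rexp (h x) * bw a b x with hZ
  set B := ∫ x in (0:ℝ)..1, bw a b x with hB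
  have hec : Continuous fun x => rexp (h x) := by fun_prop
  have hZp : 0 < Z := bw_int_pos a b hec fun x => exp_pos _
  have hBp : 0 < B := by
    have := bw_int_pos a b (e := fun _ => 1) continuous_const fun x => one_pos
    simpa using this
  have c1 := (bw_cont a b)
  have c2 : Continuous fun x => rexp (h x) * bw a b x := hec.mul c1
  obtain ⟨T, hTc, hTI, hGF, hTd⟩ := exists_transport (F := fun x => (∫ u in (0:ℝ)..x, bw a b u) / B)
    (G := fun x => (∫ u in (0:ℝ)..x, rexp (h u) * bw a b u) / Z) (f := fun x => bw a b x / B)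
    (g := fun x => rexp (h x) * bw a b x / Z)
    (fun x => (intervalIntegral.integral_hasDerivAt_right (c1.intervalIntegrable _ _)
      (c1.stronglyMeasurableAtFilter _ _) c1.continuousAt).div_const B)
    (fun x => (intervalIntegral.integral_hasDerivAt_right (c2.intervalIntegrable _ _)
      (c2.stronglyMeasurableAtFilter _ _) c2.continuousAt).div_const Z)
    (fun x hx => div_pos (bw_pos a b hx) hBp)
    (fun x hx => div_pos (mul_pos (exp_pos _) (bw_pos a b hx)) hZp)
    (by simp) (div_self hBp.ne') (by simp) (div_self hZp.ne')
  obtain ⟨H, hH⟩ : ∃ H : ℝ, ∀ x ∈ Icc (0:ℝ) 1, rexp (h x) ≤ H := by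
    obtain ⟨H, hH⟩ := (isCompact_Icc (a := (0:ℝ)) (b := 1)).bddAbove_image hec.continuousOn
    exact ⟨H, fun x hx => hH ⟨x, hx, rfl⟩⟩
  have hHp : 0 < H := (exp_pos (h 0)).trans_le (hH 0 ⟨le_rfl, zero_le_one⟩)
  set C := |log (H / Z)| with hC
  -- bounds on T
  have bT : ∀ x ∈ Ioo (0:ℝ) 1, |log (T x)| ≤ |log x| + C := by
    intro x hx
    have hx' : x ∈ Icc (0:ℝ) 1 := ⟨hx.1.le, hx.2.le⟩
    have hT := hTI x hx
    refine log_lower (a := a) hx.1 hT.1 (by positivity) hT.2.le ?_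
    have h1 := bw_lower a b hx'
    have h2 := bw_upper a b hec (fun x => exp_pos _) hH ⟨hT.1.le, hT.2.le⟩
    have h3 := hGF x hx'
    rw [div_eq_div_iff hZp.ne' hBp.ne'] at h3
    rw [← hB] at h1
    rw [div_mul_eq_mul_div, le_div_iff₀ hZp]
    refine le_of_mul_le_mul_right ?_ hBp
    nlinarith
  have hGF' : ∀ x ∈ Icc (0:ℝ) 1, (∫ u in (T x)..1, rexp (h u) * bw a b u) / Z =
      (∫ u in x..1, bw a b u) / B := by
    intro x hx
    have h3 := hGF x hx
    have h4 := intervalIntegral.integral_add_adjacent_intervals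
      (c2.intervalIntegrable (μ := volume) 0 (T x)) (c2.intervalIntegrable (T x) 1)
    have h5 := intervalIntegral.integral_add_adjacent_intervals
      (c1.intervalIntegrable (μ := volume) 0 x) (c1.intervalIntegrable x 1)
    rw [← hZ] at h4
    rw [← hB] at h5
    have h6 : (∫ u in (T x)..1, rexp (h u) * bw a b u) / Z = 1 - (∫ u in (0:ℝ)..(T x), rexp (h u) * bw a b u) / Z := by
      field_simp; linarith
    rw [h6, h3]; field_simp; linarith
  have bT' : ∀ x ∈ Ioo (0:ℝ) 1, |log (1 - T x)| ≤ |log (1 - x)| + C := by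
    intro x hx
    have hx' : x ∈ Icc (0:ℝ) 1 := ⟨hx.1.le, hx.2.le⟩
    have hT := hTI x hx
    refine log_lower (a := b) (by linarith [hx.2]) (by linarith [hT.2]) (by positivity) (by linarith [hT.1]) ?_
    have h1 := bw_lower b a (x := 1 - x) ⟨by linarith [hx.2], by linarith [hx.1]⟩
    have h2 := bw_upper b a (e := fun u => rexp (h (1 - u))) (by fun_prop) (fun x => exp_pos _) (H := H)
      (fun x hx => hH (1 - x) ⟨by linarith [hx.2], by linarith [hx.1]⟩) (T := 1 - T x) ⟨by linarith [hT.2], by linarith [hT.1]⟩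
    have h3 := hGF' x hx'
    rw [div_eq_div_iff hZp.ne' hBp.ne'] at h3
    have h4 := bw_reflect a b (fun u => rexp (h u)) (T x)
    have h5 := bw_reflect a b (fun u => 1) x
    have h6 := bw_reflect a b (fun u => 1) 0
    simp only [one_mul, sub_zero] at h5 h6
    rw [← hB] at h6
    rw [← h6, ← h5] at h1
    rw [← h4] at h2
    rw [div_mul_eq_mul_div, le_div_iff₀ hZp]
    refine le_of_mul_le_mul_right ?_ hBp
    nlinarith
  set Δ : ℝ → ℝ := fun x => log (T x) - log (1 - T x) - log x + log (1 - x) with hΔ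
  set Θ : ℝ → ℝ := fun x => bw (a + 1) (b + 1) x * Δ x with hΘ
  have hΘ0 : Θ 0 = 0 := by simp [hΘ, bw]
  have hΘ1 : Θ 1 = 0 := by simp [hΘ, bw]
  set E : ℝ → ℝ := fun x => 2 * (|1 - x| * |x * log x|) + 2 * (|x| * |(1 - x) * log (1 - x)|) + 2 * C * |x * (1 - x)| with hE
  have hEc : Continuous E := by
    have k1 : Continuous fun x : ℝ => x * log x := Real.continuous_mul_log
    have k2 : Continuous fun x : ℝ => (1 - x) * log (1 - x) := k1.comp (continuous_const.sub continuous_id)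
    have k3 : Continuous fun x : ℝ => (1 - x) := by fun_prop
    exact ((continuous_const.mul (k3.abs.mul k1.abs)).add (continuous_const.mul (continuous_abs.mul k2.abs))).add (by fun_prop)
  have hΘE : ∀ x ∈ Icc (0:ℝ) 1, |Θ x| ≤ E x := by
    intro x hx
    rcases eq_or_lt_of_le hx.1 with rfl | h0
    · rw [hΘ0, abs_zero]; simp only [hE]; positivity
    rcases eq_or_lt_of_le hx.2 with rfl | h1
    · rw [hΘ1, abs_zero]; simp only [hE]; positivity
    have hxI : x ∈ Ioo (0:ℝ) 1 := ⟨h0, h1⟩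
    have t1 := bT x hxI
    have t2 := bT' x hxI
    have h1x : 0 < 1 - x := by linarith
    have hb1 : bw (a + 1) (b + 1) x ≤ x * (1 - x) := by
      unfold bw
      have e1 : x ^ (a + 1) ≤ x := by
        calc x ^ (a+1) ≤ x ^ 1 := pow_le_pow_of_le_one h0.le h1.le (by omega)
          _ = x := pow_one x
      have e2 : (1 - x) ^ (b + 1) ≤ 1 - x := by
        calc (1-x) ^ (b+1) ≤ (1-x) ^ 1 := pow_le_pow_of_le_one h1x.le (by linarith) (by omega)
          _ = 1 - x := pow_one _
      exact mul_le_mul e1 e2 (by positivity) h0.le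
    have hΔb : |Δ x| ≤ 2 * |log x| + 2 * |log (1 - x)| + 2 * C := by
      simp only [hΔ]
      have s1 : |log (T x) - log (1 - T x) - log x + log (1 - x)| ≤ |log (T x)| + |log (1 - T x)| + |log x| + |log (1 - x)| := by
        refine (abs_add_le _ _).trans ?_
        gcongr
        refine (abs_sub _ _).trans ?_
        gcongr
        exact abs_sub _ _
      linarith
    have hb0 := (bw_pos (a+1) (b+1) hxI).le
    simp only [hΘ, abs_mul, abs_of_nonneg hb0]
    calc bw (a+1) (b+1) x * |Δ x| ≤ (x * (1 - x)) * (2 * |log x| + 2 * |log (1 - x)| + 2 * C) := by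
          gcongr
      _ = E x := by
          simp only [hE, abs_mul, abs_of_pos h0, abs_of_pos h1x]; ring
  have hΘd : ∀ x ∈ Ioo (0:ℝ) 1, HasDerivAt Θ (bw a b x * ((a + 1) - (a + b + 2) * x) * Δ x +
      bw (a+1) (b+1) x * (bw a b x / B / (rexp (h (T x)) * bw a b (T x) / Z) / (T x * (1 - T x)) - 1 / (x * (1 - x)))) x := by
    intro x hx
    have hT := hTI x hx
    have hd := hTd x hx
    set D := bw a b x / B / (rexp (h (T x)) * bw a b (T x) / Z)
    have n1 : T x ≠ 0 := hT.1.ne'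
    have n2 : 1 - T x ≠ 0 := by linarith [hT.2]
    have n3 : x ≠ 0 := hx.1.ne'
    have n4 : 1 - x ≠ 0 := by linarith [hx.2]
    have d1 : HasDerivAt Δ (D / (T x * (1 - T x)) - 1 / (x * (1 - x))) x := by
      have := ((((hd.log n1).sub ((hd.const_sub 1).log n2)).sub (Real.hasDerivAt_log n3)).add
        (((hasDerivAt_id x).const_sub 1).log n4))
      convert! this using 1
      field_simp
      simp only [id]
      field_simp
      ring
    have d2 : HasDerivAt (bw (a+1) (b+1)) (bw a b x * ((a + 1) - (a + b + 2) * x)) x := by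
      have := ((hasDerivAt_pow (a+1) x).mul (((hasDerivAt_id x).const_sub 1).pow (b+1)))
      convert! this using 1
      simp [bw]
      ring
    exact d2.mul d1
  have hΘc : ContinuousOn Θ (Icc 0 1) := by
    intro x hx
    have endp : ∀ x ∈ Icc (0:ℝ) 1, Θ x = 0 → E x = 0 → ContinuousWithinAt Θ (Icc 0 1) x := by
      intro x hx h0 h1
      unfold ContinuousWithinAt
      rw [h0]
      refine squeeze_zero_norm' (a := E) ?_ ?_
      · filter_upwards [self_mem_nhdsWithin] with y hy using hΘE y hy
      · rw [← h1]; exact hEc.continuousAt.continuousWithinAt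
    rcases eq_or_lt_of_le hx.1 with rfl | h0
    · exact endp 0 hx hΘ0 (by simp [hE])
    rcases eq_or_lt_of_le hx.2 with rfl | h1
    · exact endp 1 hx hΘ1 (by simp [hE])
    exact (hΘd x ⟨h0, h1⟩).continuousAt.continuousWithinAt
  have key := intervalIntegral.integral_le_sub_of_hasDeriv_right_of_le (g := Θ)
    (φ := fun x => bw a b x * log (Z / B) - bw a b x * g x) zero_le_one hΘc
    (fun x hx => (hΘd x hx).hasDerivWithinAt) ?_ ?_
  · have i1 : IntervalIntegrable (fun x => bw a b x * log (Z / B)) volume 0 1 :=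
      Continuous.intervalIntegrable (c1.mul continuous_const) _ _
    rw [hΘ0, hΘ1, sub_zero, intervalIntegral.integral_sub i1 hgi,
      intervalIntegral.integral_mul_const, ← hB] at key
    linarith
  · have := ((c1.mul (continuous_const (y := log (Z/B)))).intervalIntegrable (μ := volume) 0 1).sub hgi
    rw [intervalIntegrable_iff_integrableOn_Icc_of_le zero_le_one] at this
    exact this
  · intro x hx
    have hT := hTI x hx
    have b1 := bw_pos a b hx
    have b2 := bw_pos a b hT
    have n1 := hT.1
    have n2 : 0 < 1 - T x := by linarith [hT.2]
    have n3 := hx.1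
    have n4 : 0 < 1 - x := by linarith [hx.2]
    have e1 : bw (a+1) (b+1) x = bw a b x * (x * (1 - x)) := by unfold bw; ring
    have hy := hyp x hx (T x) hT
    set D := bw a b x / B / (rexp (h (T x)) * bw a b (T x) / Z) with hD
    have hDp : 0 < D := by positivity
    have lD : log D = log (bw a b x) - log B - (h (T x) + log (bw a b (T x)) - log Z) := by
      rw [hD, log_div (by positivity) (by positivity), log_div b1.ne' hBp.ne', log_div (by positivity) hZp.ne',
        log_mul (exp_pos _).ne' b2.ne', log_exp]
    have lb : ∀ y, 0 < y → 0 < 1 - y → log (bw a b y) = a * log y + b * log (1 - y) := by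
      intro y h1 h2
      unfold bw
      rw [log_mul (by positivity) (by positivity), log_pow, log_pow]
    rw [lb x n3 n4, lb (T x) n1 n2] at lD
    have lu : log (D * (x * (1 - x)) / (T x * (1 - T x))) = log D + log x + log (1 - x) - log (T x) - log (1 - T x) := by
      rw [log_div (by positivity) (by positivity), log_mul hDp.ne' (by positivity), log_mul n3.ne' n4.ne',
        log_mul n1.ne' n2.ne']; ring
    have lu2 := Real.log_le_sub_one_of_pos (show 0 < D * (x * (1 - x)) / (T x * (1 - T x)) by positivity)
    rw [log_div hZp.ne' hBp.ne']
    have e2 : bw (a+1) (b+1) x * (D / (T x * (1 - T x)) - 1 / (x * (1 - x))) =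
        bw a b x * (D * (x * (1 - x)) / (T x * (1 - T x)) - 1) := by
      rw [e1]; field_simp
    rw [e2, mul_assoc, ← mul_add, ← mul_sub]
    refine mul_le_mul_of_nonneg_left ?_ b1.le
    simp only [kl2] at hy
    simp only [hΔ]
    rw [lu] at lu2
    nlinarith

end
end

section
open MeasureTheory Real Set Filter Topology

noncomputable section

lemma hasDerivAt_max_sq (v : ℝ) : HasDerivAt (fun w : ℝ => max w 0 ^ 2) (2 * max v 0) v := by
  rcases lt_trichotomy v 0 with h | h | h
  · rw [max_eq_right h.le, mul_zero]
    refine (hasDerivAt_const v (0:ℝ)).congr_of_eventuallyEq ?_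
    filter_upwards [Iio_mem_nhds h] with w hw
    rw [max_eq_right (le_of_lt hw)]; simp
  · subst h
    rw [max_self, mul_zero]
    have : (fun w : ℝ => max w 0 ^ 2) =O[𝓝 0] fun w => ‖w - 0‖ ^ 2 := by
      refine Asymptotics.IsBigO.of_bound 1 (Eventually.of_forall fun w => ?_)
      simp only [sub_zero, norm_pow, norm_norm, one_mul]
      gcongr
      rw [Real.norm_eq_abs, Real.norm_eq_abs, abs_of_nonneg (le_max_right _ _)]
      exact max_le (le_abs_self _) (abs_nonneg _)
    have := Asymptotics.IsBigO.hasFDerivAt (𝕜 := ℝ) this one_lt_two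
    convert! this.hasDerivAt using 1
  · rw [max_eq_left h.le]
    have := hasDerivAt_pow 2 v
    refine (HasDerivAt.congr_of_eventuallyEq (f := fun w : ℝ => w ^ 2) (by simpa using this) ?_)
    filter_upwards [Ioi_mem_nhds h] with w hw
    rw [max_eq_left (le_of_lt hw)]

lemma tri_int_half {c m L : ℝ} (hm : 0 < m) (_hL : 0 ≤ L) :
    ∫ u in (0:ℝ)..L, max (c - m * u) 0 ≤ max c 0 ^ 2 / (2 * m) := by
  have hd : ∀ u ∈ uIcc 0 L, HasDerivAt (fun u : ℝ => - (max (c - m * u) 0 ^ 2) / (2 * m)) (max (c - m * u) 0) u := by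
    intro u _
    have h1 : HasDerivAt (fun u : ℝ => c - m * u) (-m) u := by
      simpa using ((hasDerivAt_id u).const_mul m).const_sub c
    have := (((hasDerivAt_max_sq (c - m * u)).comp u h1).neg).div_const (2 * m)
    convert! this using 1
    field_simp
  rw [intervalIntegral.integral_eq_sub_of_hasDerivAt hd
    (Continuous.intervalIntegrable (by fun_prop) _ _)]
  simp only [mul_zero, sub_zero]
  have : 0 ≤ max (c - m * L) 0 ^ 2 / (2 * m) := by positivity
  rw [neg_div, neg_div]; linarith

lemma tri_int {c m ρ : ℝ} (hm : 0 < m) (hc : 0 ≤ c) (hρ : ρ ∈ Icc (0:ℝ) 1) :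
    ∫ x in (0:ℝ)..1, max (c - m * |ρ - x|) 0 ≤ c ^ 2 / m := by
  have hc1 : Continuous fun x => max (c - m * |ρ - x|) 0 := by fun_prop
  rw [← intervalIntegral.integral_add_adjacent_intervals (hc1.intervalIntegrable 0 ρ) (hc1.intervalIntegrable ρ 1)]
  have e1 : ∫ x in (0:ℝ)..ρ, max (c - m * |ρ - x|) 0 = ∫ u in (0:ℝ)..ρ, max (c - m * u) 0 := by
    have := intervalIntegral.integral_comp_sub_left (a := 0) (b := ρ) (fun u => max (c - m * u) 0) ρ
    rw [sub_self, sub_zero] at this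
    rw [← this]
    refine intervalIntegral.integral_congr fun x hx => ?_
    rw [uIcc_of_le hρ.1] at hx
    rw [abs_of_nonneg (by linarith [hx.2])]
  have e2 : ∫ x in ρ..1, max (c - m * |ρ - x|) 0 = ∫ u in (0:ℝ)..(1 - ρ), max (c - m * u) 0 := by
    have := intervalIntegral.integral_comp_sub_right (a := ρ) (b := 1) (fun u => max (c - m * u) 0) ρ
    rw [sub_self] at this
    rw [← this]
    refine intervalIntegral.integral_congr fun x hx => ?_
    rw [uIcc_of_le hρ.2] at hx
    rw [abs_of_nonpos (by linarith [hx.1]), neg_sub]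
  rw [e1, e2]
  have h1 := tri_int_half (c := c) hm hρ.1
  have h2 := tri_int_half (c := c) hm (show 0 ≤ 1 - ρ by linarith [hρ.2])
  rw [max_eq_left hc] at h1 h2
  have : c ^ 2 / m = c ^ 2 / (2 * m) + c ^ 2 / (2 * m) := by field_simp; ring
  linarith

/-- the transport kernel -/
def Kk (h' : ℝ → ℝ) (M x ρ : ℝ) : ℝ := max (|h' ρ| - M / (ρ * (1 - ρ)) * |ρ - x|) 0

lemma Kk_nonneg (h' : ℝ → ℝ) (M x ρ : ℝ) : 0 ≤ Kk h' M x ρ := le_max_right _ _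

lemma Kk_meas {h' : ℝ → ℝ} (hc : Continuous h') (M : ℝ) : Measurable fun p : ℝ × ℝ => Kk h' M p.1 p.2 := by
  unfold Kk
  have := hc.measurable
  fun_prop

lemma Kk_le {h' : ℝ → ℝ} {M x ρ : ℝ} (hM : 0 ≤ M) (hρ : ρ ∈ Icc (0:ℝ) 1) : Kk h' M x ρ ≤ |h' ρ| := by
  unfold Kk
  refine max_le ?_ (abs_nonneg _)
  have : 0 ≤ 1 - ρ := by linarith [hρ.2]
  have h0 := hρ.1
  have : 0 ≤ M / (ρ * (1 - ρ)) * |ρ - x| := by positivity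
  linarith

lemma Kk_integrable {h' : ℝ → ℝ} (hc : Continuous h') {M : ℝ} (hM : 0 ≤ M) :
    Integrable (fun p : ℝ × ℝ => Kk h' M p.1 p.2)
      ((volume.restrict (Ioc (0:ℝ) 1)).prod (volume.restrict (Ioc (0:ℝ) 1))) := by
  obtain ⟨A, hA⟩ := (isCompact_Icc (a := (0:ℝ)) (b := 1)).exists_bound_of_continuousOn hc.continuousOn
  refine Integrable.of_bound (Kk_meas hc M).aestronglyMeasurable A ?_
  rw [Measure.prod_restrict]
  filter_upwards [ae_restrict_mem (measurableSet_Ioc.prod measurableSet_Ioc)] with p hp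
  have h2 : p.2 ∈ Icc (0:ℝ) 1 := ⟨hp.2.1.le, hp.2.2⟩
  rw [Real.norm_eq_abs, abs_of_nonneg (Kk_nonneg _ _ _ _)]
  exact (Kk_le hM h2).trans (hA _ h2)

lemma Kk_integrable1 {h' : ℝ → ℝ} (hc : Continuous h') {M : ℝ} (hM : 0 ≤ M) (x : ℝ) :
    IntervalIntegrable (fun ρ => Kk h' M x ρ) volume 0 1 := by
  obtain ⟨A, hA⟩ := (isCompact_Icc (a := (0:ℝ)) (b := 1)).exists_bound_of_continuousOn hc.continuousOn
  rw [intervalIntegrable_iff_integrableOn_Ioc_of_le zero_le_one]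
  refine Integrable.of_bound ((Kk_meas hc M).comp (measurable_const.prodMk measurable_id)).aestronglyMeasurable A ?_
  filter_upwards [ae_restrict_mem measurableSet_Ioc] with p hp
  have h2 : p ∈ Icc (0:ℝ) 1 := ⟨hp.1.le, hp.2⟩
  rw [Real.norm_eq_abs]
  change |Kk h' M x p| ≤ A
  rw [abs_of_nonneg (Kk_nonneg _ _ _ _)]
  exact (Kk_le hM h2).trans (hA _ h2)

lemma kl2_deriv {x ρ : ℝ} (hρ : ρ ∈ Ioo (0:ℝ) 1) :
    HasDerivAt (fun y => kl2 x y) ((ρ - x) / (ρ * (1 - ρ))) ρ := by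
  have n1 : ρ ≠ 0 := hρ.1.ne'
  have n2 : 1 - ρ ≠ 0 := by linarith [hρ.2]
  unfold kl2
  have := (((Real.hasDerivAt_log n1).const_sub (log x)).const_mul x).add
    ((((((hasDerivAt_id ρ).const_sub 1).log n2)).const_sub (log (1 - x))).const_mul (1 - x))
  convert! this using 1
  simp only [id]
  field_simp
  ring

lemma h_bound {h h' : ℝ → ℝ} (hd : ∀ x, HasDerivAt h (h' x) x) (hc : Continuous h') {M : ℝ} (hM : 0 ≤ M)
    {x y : ℝ} (hx : x ∈ Ioo (0:ℝ) 1) (hy : y ∈ Ioo (0:ℝ) 1) :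
    h y ≤ (h x + ∫ ρ in (0:ℝ)..1, Kk h' M x ρ) + M * kl2 x y := by
  have hD : ∀ ρ ∈ Ioo (0:ℝ) 1, HasDerivAt (fun y => h y - M * kl2 x y) (h' ρ - M * ((ρ - x) / (ρ * (1 - ρ)))) ρ :=
    fun ρ hρ => (hd ρ).sub ((kl2_deriv hρ).const_mul M)
  have hxx : kl2 x x = 0 := by simp [kl2]
  have hcont : ContinuousOn (fun ρ => h' ρ - M * ((ρ - x) / (ρ * (1 - ρ)))) (Ioo 0 1) := by
    intro ρ hρ
    have n1 : ρ ≠ 0 := hρ.1.ne'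
    have n2 : 1 - ρ ≠ 0 := by linarith [hρ.2]
    have : ContinuousAt h' ρ := hc.continuousAt
    refine ContinuousAt.continuousWithinAt ?_
    refine this.sub (continuousAt_const.mul (ContinuousAt.div (by fun_prop) (by fun_prop) (mul_ne_zero n1 n2)))
  have sub : uIcc x y ⊆ Ioo 0 1 := by
    intro z hz
    rw [mem_uIcc] at hz
    rcases hz with hz | hz
    · exact ⟨hx.1.trans_le hz.1, hz.2.trans_lt hy.2⟩
    · exact ⟨hy.1.trans_le hz.1, hz.2.trans_lt hx.2⟩
  have sub' : uIcc x y ⊆ uIcc 0 1 := by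
    rw [uIcc_of_le (zero_le_one (α := ℝ))]; exact sub.trans Ioo_subset_Icc_self
  have ii : IntervalIntegrable (fun ρ => h' ρ - M * ((ρ - x) / (ρ * (1 - ρ)))) volume x y :=
    (hcont.mono sub).intervalIntegrable
  have ftc := intervalIntegral.integral_eq_sub_of_hasDerivAt (fun ρ hρ => hD ρ (sub hρ)) ii
  have Ki := Kk_integrable1 hc hM x
  have Kmono : ∀ {a b : ℝ}, 0 ≤ a → a ≤ b → b ≤ 1 → ∫ ρ in a..b, Kk h' M x ρ ≤ ∫ ρ in (0:ℝ)..1, Kk h' M x ρ := by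
    intro a b ha hab hb
    refine intervalIntegral.integral_mono_interval ha hab hb (Eventually.of_forall fun ρ => Kk_nonneg _ _ _ _) Ki
  have m1 : ∫ ρ in x..y, (h' ρ - M * ((ρ - x) / (ρ * (1 - ρ)))) ≤ ∫ ρ in (0:ℝ)..1, Kk h' M x ρ := by
    rcases le_total x y with hxy | hxy
    · refine le_trans ?_ (Kmono hx.1.le hxy hy.2.le)
      refine intervalIntegral.integral_mono_on hxy ii (Ki.mono_set sub') fun ρ hρ => ?_
      refine le_trans ?_ (le_max_left _ _)
      rw [abs_of_nonneg (show 0 ≤ ρ - x by linarith [hρ.1]), mul_div_assoc', div_mul_eq_mul_div]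
      linarith [le_abs_self (h' ρ)]
    · rw [intervalIntegral.integral_symm, ← intervalIntegral.integral_neg]
      refine le_trans ?_ (Kmono hy.1.le hxy hx.2.le)
      refine intervalIntegral.integral_mono_on hxy ii.symm.neg (Ki.mono_set sub').symm fun ρ hρ => ?_
      refine le_trans ?_ (le_max_left _ _)
      rw [abs_of_nonpos (show ρ - x ≤ 0 by linarith [hρ.2]), mul_neg, mul_div_assoc', div_mul_eq_mul_div]
      linarith [neg_le_abs (h' ρ)]
  rw [ftc, hxx] at m1
  linarith

lemma bw_beta (a b : ℕ) : ((a + b + 1 : ℕ) : ℝ) * (a + b).choose a * ∫ x in (0:ℝ)..1, bw a b x = 1 := by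
  induction b generalizing a with
  | zero =>
    simp only [bw, pow_zero, mul_one, integral_pow, add_zero, Nat.choose_self]
    push_cast
    have : (a + 1 : ℝ) ≠ 0 := by positivity
    simp
    field_simp
  | succ b ih =>
    have i1 := (bw_cont a (b+1)).intervalIntegrable (μ := volume) 0 1
    have i2 := (bw_cont (a+1) b).intervalIntegrable (μ := volume) 0 1
    have key : (a + 1 : ℝ) * (∫ x in (0:ℝ)..1, bw a (b+1) x) = (b + 1) * ∫ x in (0:ℝ)..1, bw (a+1) b x := by
      have hd : ∀ x ∈ uIcc (0:ℝ) 1, HasDerivAt (bw (a+1) (b+1)) ((a + 1 : ℝ) * bw a (b+1) x - (b + 1) * bw (a+1) b x) x := by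
        intro x _
        have := ((hasDerivAt_pow (a+1) x).mul (((hasDerivAt_id x).const_sub 1).pow (b+1)))
        convert! this using 1
        simp [bw]
        ring
      have := intervalIntegral.integral_eq_sub_of_hasDerivAt hd ((i1.const_mul _).sub (i2.const_mul _))
      rw [intervalIntegral.integral_sub (i1.const_mul _) (i2.const_mul _), intervalIntegral.integral_const_mul,
        intervalIntegral.integral_const_mul] at this
      simp [bw] at this
      simp only [bw]
      linarith
    have h := ih (a + 1)
    rw [show a + 1 + b = a + (b + 1) by ring] at h
    have hch := Nat.choose_succ_right_eq (a + (b + 1)) a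
    rw [show a + (b + 1) - a = b + 1 by omega] at hch
    have hch' : ((a + (b + 1)).choose (a + 1) : ℝ) * (a + 1) = (a + (b + 1)).choose a * (b + 1) := by exact_mod_cast hch
    refine Eq.trans ?_ h
    have ha : (a + 1 : ℝ) ≠ 0 := by positivity
    refine mul_left_cancel₀ ha ?_
    linear_combination ((a + (b + 1) + 1 : ℕ) : ℝ) * (a + (b + 1)).choose a * key - ((a + (b + 1) + 1 : ℕ) : ℝ) * (∫ x in (0:ℝ)..1, bw (a+1) b x) * hch'

/-- sum of log-Laplace transforms of the beta weights -/
theorem sum_log_bound (N : ℕ) (hN : 1 ≤ N) {h h' : ℝ → ℝ} (hd : ∀ x, HasDerivAt h (h' x) x) (hc : Continuous h') :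
    ∑ k ∈ Finset.range N, log ((∫ x in (0:ℝ)..1, rexp (h x) * bw k (N - 1 - k) x) / ∫ x in (0:ℝ)..1, bw k (N - 1 - k) x)
      ≤ N * (∫ x in (0:ℝ)..1, h x) + ∫ x in (0:ℝ)..1, x * (1 - x) * h' x ^ 2 := by
  have hhc : Continuous h := continuous_iff_continuousAt.2 fun x => (hd x).continuousAt
  set M : ℝ := N + 1 with hM
  have hM0 : 0 < M := by positivity
  set W : ℝ → ℝ := fun x => ∫ ρ in (0:ℝ)..1, Kk h' M x ρ with hW
  have KI := Kk_integrable hc hM0.le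
  have Wi : IntervalIntegrable W volume 0 1 := by
    rw [intervalIntegrable_iff_integrableOn_Ioc_of_le zero_le_one]
    have := KI.integral_prod_left
    simp only [hW, intervalIntegral.integral_of_le (zero_le_one (α := ℝ))]
    exact this
  set g : ℝ → ℝ := fun x => h x + W x with hg
  have gi : IntervalIntegrable g volume 0 1 := (hhc.intervalIntegrable _ _).add Wi
  have gib : ∀ a b, IntervalIntegrable (fun x => bw a b x * g x) volume 0 1 := fun a b =>
    gi.continuousOn_mul (bw_cont a b).continuousOn
  have step : ∀ k ∈ Finset.range N, log ((∫ x in (0:ℝ)..1, rexp (h x) * bw k (N - 1 - k) x) / ∫ x in (0:ℝ)..1, bw k (N - 1 - k) x)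
      ≤ ∫ x in (0:ℝ)..1, N * (N-1).choose k * (bw k (N - 1 - k) x * g x) := by
    intro k hk
    rw [Finset.mem_range] at hk
    have hkN : k + (N - 1 - k) = N - 1 := by omega
    have hMk : ((k : ℕ) : ℝ) + ((N - 1 - k : ℕ) : ℝ) + 2 = M := by
      have : ((k + (N - 1 - k) + 2 : ℕ) : ℝ) = ((N + 1 : ℕ) : ℝ) := by congr 1; omega
      push_cast at this; rw [hM]; linarith
    have t := transport_entropy k (N - 1 - k) hhc (gib k (N-1-k)) (fun x hx y hy => by
      rw [hMk]; exact h_bound hd hc hM0.le hx hy)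
    have be := bw_beta k (N - 1 - k)
    rw [hkN, show N - 1 + 1 = N by omega] at be
    rw [intervalIntegral.integral_const_mul]
    have hp : (0:ℝ) ≤ N * (N-1).choose k := by positivity
    have := mul_le_mul_of_nonneg_left t hp
    refine le_trans (le_of_eq ?_) this
    rw [mul_comm (log _), ← mul_assoc, be, one_mul]
  refine (Finset.sum_le_sum step).trans ?_
  rw [← intervalIntegral.integral_finsetSum (fun k _ => (gib k _).const_mul _)]
  have e1 : ∀ x, ∑ k ∈ Finset.range N, (N * (N-1).choose k * (bw k (N - 1 - k) x * g x) : ℝ) = N * g x := by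
    intro x
    have := add_pow x (1 - x) (N - 1)
    rw [show N - 1 + 1 = N by omega, show x + (1 - x) = 1 by ring, one_pow] at this
    calc _ = N * g x * ∑ k ∈ Finset.range N, x ^ k * (1 - x) ^ (N - 1 - k) * ((N-1).choose k : ℝ) := by
          rw [Finset.mul_sum]; refine Finset.sum_congr rfl fun k _ => ?_; unfold bw; ring
      _ = _ := by rw [← this, mul_one]
  simp_rw [e1]
  rw [intervalIntegral.integral_const_mul]
  simp only [hg]
  rw [intervalIntegral.integral_add (hhc.intervalIntegrable _ _) Wi, mul_add]
  gcongr
  -- W bound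
  have hWI : ∫ x in (0:ℝ)..1, W x ≤ ∫ ρ in (0:ℝ)..1, (ρ * (1 - ρ) * h' ρ ^ 2) / M := by
    have sw : ∫ x in (0:ℝ)..1, W x = ∫ ρ in (0:ℝ)..1, ∫ x in (0:ℝ)..1, Kk h' M x ρ := by
      simp only [hW, intervalIntegral.integral_of_le (zero_le_one (α := ℝ))]
      exact integral_integral_swap KI
    rw [sw]
    refine intervalIntegral.integral_mono_on_of_le_Ioo zero_le_one ?_ (Continuous.intervalIntegrable (by fun_prop) _ _) ?_
    · rw [intervalIntegrable_iff_integrableOn_Ioc_of_le zero_le_one]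
      have := KI.integral_prod_right
      simp only [intervalIntegral.integral_of_le (zero_le_one (α := ℝ))]
      exact this
    · intro ρ hρ
      have n1 := hρ.1
      have n2 : 0 < 1 - ρ := by linarith [hρ.2]
      have := tri_int (c := |h' ρ|) (m := M / (ρ * (1 - ρ))) (ρ := ρ) (by positivity) (abs_nonneg _) ⟨hρ.1.le, hρ.2.le⟩
      refine le_trans this (le_of_eq ?_)
      rw [sq_abs]; field_simp
  rw [intervalIntegral.integral_div] at hWI
  have hE : 0 ≤ ∫ ρ in (0:ℝ)..1, (ρ * (1 - ρ) * h' ρ ^ 2) := by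
    refine intervalIntegral.integral_nonneg zero_le_one fun ρ hρ => ?_
    have n1 := hρ.1
    have n2 : 0 ≤ 1 - ρ := by linarith [hρ.2]
    positivity
  rw [le_div_iff₀ hM0] at hWI
  have hN0 : (0:ℝ) ≤ N := by positivity
  have hW0 : 0 ≤ ∫ x in (0:ℝ)..1, W x := intervalIntegral.integral_nonneg zero_le_one fun x _ =>
    intervalIntegral.integral_nonneg zero_le_one fun ρ _ => Kk_nonneg _ _ _ _
  nlinarith

end
end

section
open MeasureTheory Real Polynomial

noncomputable section

/-- integral of a polynomial over `[-1,1]` -/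
def Lint : ℝ[X] →ₗ[ℝ] ℝ where
  toFun p := ∫ t in (-1:ℝ)..1, p.eval t
  map_add' p q := by
    simp only [eval_add]
    exact intervalIntegral.integral_add (p.continuous.intervalIntegrable _ _) (q.continuous.intervalIntegrable _ _)
  map_smul' c p := by
    simp only [eval_smul, smul_eq_mul, RingHom.id_apply]
    exact intervalIntegral.integral_const_mul _ _

lemma Lint_apply (p : ℝ[X]) : Lint p = ∫ t in (-1:ℝ)..1, p.eval t := rfl

lemma Lint_C_mul (c : ℝ) (p : ℝ[X]) : Lint (C c * p) = c * Lint p := by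
  rw [← smul_eq_C_mul, map_smul, smul_eq_mul]

lemma Lint_deriv (p : ℝ[X]) : Lint (derivative p) = p.eval 1 - p.eval (-1) := by
  rw [Lint_apply]
  exact intervalIntegral.integral_eq_sub_of_hasDerivAt (fun x _ => p.hasDerivAt x)
    ((derivative p).continuous.intervalIntegrable _ _)

lemma Lint_parts (p q : ℝ[X]) : Lint (derivative p * q) =
    p.eval 1 * q.eval 1 - p.eval (-1) * q.eval (-1) - Lint (p * derivative q) := by
  have := Lint_deriv (p * q)
  rw [derivative_mul, map_add, eval_mul, eval_mul] at this
  linarith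

lemma Lint_sq_eq_zero {p : ℝ[X]} (h : Lint (p * p) = 0) : p = 0 := by
  by_contra hp
  obtain ⟨c, hc, hcI⟩ : ∃ c ∈ Set.Icc (-1:ℝ) 1, p.eval c ≠ 0 := by
    by_contra! hcon
    have : (Set.Icc (-1:ℝ) 1) ⊆ {x | p.IsRoot x} := fun x hx => hcon x hx
    exact (Set.Icc_infinite (by norm_num : (-1:ℝ) < 1)) ((finite_setOfPred_isRoot hp).subset this)
  have : 0 < Lint (p * p) := by
    rw [Lint_apply]
    refine intervalIntegral.integral_pos (by norm_num) (p * p).continuous.continuousOn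
      (fun x _ => by rw [eval_mul]; exact mul_self_nonneg _) ⟨c, hc, ?_⟩
    rw [eval_mul]; exact mul_self_pos.2 hcI
  linarith

lemma rod_eval (l j : ℕ) (hj : j < l) (t : ℝ) (ht : t ^ 2 = 1) :
    (derivative^[j] ((X ^ 2 - 1 : ℝ[X]) ^ l)).eval t = 0 := by
  obtain ⟨q, hq⟩ := pow_sub_dvd_iterate_derivative_pow (X ^ 2 - 1 : ℝ[X]) l j
  rw [hq, eval_mul, eval_pow]
  simp [ht]
  left; omega

lemma rod_parts (l j : ℕ) (hj : j ≤ l) (q : ℝ[X]) :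
    Lint (derivative^[l] ((X ^ 2 - 1 : ℝ[X]) ^ l) * q) =
      (-1) ^ j * Lint (derivative^[l - j] ((X ^ 2 - 1 : ℝ[X]) ^ l) * derivative^[j] q) := by
  induction j with
  | zero => simp
  | succ j ih =>
    rw [ih (by omega)]
    have e : l - j = (l - (j + 1)) + 1 := by omega
    rw [e, Function.iterate_succ_apply', Lint_parts, rod_eval l _ (by omega) 1 (by norm_num),
      rod_eval l _ (by omega) (-1) (by norm_num), Function.iterate_succ_apply']
    ring

lemma leg_orth {l : ℕ} {q : ℝ[X]} (hq : q.degree < l) : Lint (legendreP l * q) = 0 := by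
  rw [legendreP, mul_assoc, Lint_C_mul, rod_parts l l le_rfl, iterate_derivative_eq_zero_of_degree_lt hq]
  simp

lemma leg_orth' {l : ℕ} {q : ℝ[X]} (hq : q.degree < l) : Lint (q * legendreP l) = 0 := by
  rw [mul_comm]; exact leg_orth hq

lemma leg_one (l : ℕ) : (legendreP l).eval 1 = 1 := by
  have h := aeval_iterate_derivative_self (R := ℝ) (A := ℝ) ((X ^ 2 - 1) ^ l) l 1 (p' := (X + 1) ^ l) (by
    simp only [Algebra.algebraMap_self, Polynomial.map_id, ← mul_pow]
    congr 1; simp only [map_one]; ring)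
  rw [coe_aeval_eq_eval] at h
  rw [legendreP, eval_mul, h]
  simp
  have : ((1:ℝ) + 1) = 2 := by norm_num
  rw [this]
  have : (l.factorial : ℝ) ≠ 0 := by exact_mod_cast l.factorial_ne_zero
  field_simp

lemma leg_neg_one_sq (l : ℕ) : (legendreP l).eval (-1) ^ 2 = 1 := by
  have h := aeval_iterate_derivative_self (R := ℝ) (A := ℝ) ((X ^ 2 - 1) ^ l) l (-1) (p' := (X - 1) ^ l) (by
    simp only [Algebra.algebraMap_self, Polynomial.map_id, ← mul_pow]
    congr 1; simp only [map_one, map_neg]; ring)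
  rw [coe_aeval_eq_eval] at h
  rw [legendreP, eval_mul, h]
  simp
  have : ((-1:ℝ) - 1) = (-1) * 2 := by norm_num
  rw [this, mul_pow]
  have : (l.factorial : ℝ) ≠ 0 := by exact_mod_cast l.factorial_ne_zero
  field_simp
  exact neg_one_pow_eq_or ℝ l

lemma leg_ne_zero (l : ℕ) : legendreP l ≠ 0 := by
  intro h; have := leg_one l; rw [h] at this; simp at this

lemma leg_natDegree_le (l : ℕ) : (legendreP l).natDegree ≤ l := by
  rw [legendreP]
  refine (natDegree_C_mul_le _ _).trans ?_
  refine (natDegree_iterate_derivative _ _).trans ?_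
  have : ((X ^ 2 - 1 : ℝ[X]) ^ l).natDegree ≤ l * 2 := by
    refine natDegree_pow_le.trans ?_
    gcongr
    compute_degree
  omega

lemma leg_natDegree (l : ℕ) : (legendreP l).natDegree = l := by
  refine le_antisymm (leg_natDegree_le l) ?_
  by_contra! h
  rw [natDegree_lt_iff_degree_lt (leg_ne_zero l)] at h
  exact leg_ne_zero l (Lint_sq_eq_zero (leg_orth h))

lemma leg_degree (l : ℕ) : (legendreP l).degree = l := by
  rw [degree_eq_natDegree (leg_ne_zero l), leg_natDegree]

lemma leg_coeff_ne (l : ℕ) : (legendreP l).coeff l ≠ 0 := by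
  have := leadingCoeff_ne_zero.2 (leg_ne_zero l)
  rwa [leadingCoeff, leg_natDegree] at this

lemma degree_lt_of {q : ℝ[X]} {l : ℕ} (h1 : q.natDegree ≤ l) (h2 : q.coeff l = 0) : q.degree < l := by
  rw [degree_lt_iff_coeff_zero]
  intro m hm
  rcases eq_or_lt_of_le hm with rfl | hm
  · exact h2
  · exact coeff_eq_zero_of_natDegree_lt (by omega)

lemma sub_lead {q : ℝ[X]} {l : ℕ} (h1 : q.natDegree ≤ l) :
    (q - C (q.coeff l / (legendreP l).coeff l) * legendreP l).degree < l := by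
  refine degree_lt_of ?_ ?_
  · exact (natDegree_sub_le_of_le h1 ((natDegree_C_mul_le _ _).trans (leg_natDegree_le l))).trans (max_self l).le
  · rw [coeff_sub, coeff_C_mul, div_mul_cancel₀ _ (leg_coeff_ne l), sub_self]

lemma leg_unique {q : ℝ[X]} {l : ℕ} (h1 : q.natDegree ≤ l)
    (h2 : ∀ r : ℝ[X], r.degree < l → Lint (q * r) = 0) :
    q = C (q.coeff l / (legendreP l).coeff l) * legendreP l := by
  have hd := sub_lead h1
  set r := q - C (q.coeff l / (legendreP l).coeff l) * legendreP l with hr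
  have : Lint (r * r) = 0 := by
    nth_rw 1 [hr]
    rw [sub_mul, map_sub, h2 r hd, mul_assoc, Lint_C_mul, leg_orth hd]; ring
  exact sub_eq_zero.1 (Lint_sq_eq_zero this)

lemma leg_unique' {q : ℝ[X]} {l : ℕ} (h1 : q.natDegree ≤ l)
    (h2 : ∀ r : ℝ[X], r.degree < l → Lint (q * r) = 0) :
    q = C (q.eval 1) * legendreP l := by
  have := leg_unique h1 h2
  have h3 := congrArg (eval 1) this
  rw [eval_mul, leg_one, eval_C, mul_one] at h3
  rw [h3]; exact this

lemma leg_norm (l : ℕ) : Lint (legendreP l * legendreP l) = 2 / (2 * l + 1) := by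
  set P := legendreP l with hP
  have hr : (X * derivative P - C (l:ℝ) * P).degree < (l : WithBot ℕ) := by
    refine degree_lt_of ?_ ?_
    · refine (natDegree_sub_le_of_le (m := l) ?_ ((natDegree_C_mul_le _ _).trans (leg_natDegree_le l))).trans (max_self l).le
      by_cases h0 : derivative P = 0
      · simp [h0]
      · have h1 := natDegree_derivative_le P
        have h2 : P.natDegree ≠ 0 := fun h => h0 (derivative_of_natDegree_zero h)
        have h3 := leg_natDegree l
        rw [← hP] at h3
        refine natDegree_mul_le.trans ?_
        rw [natDegree_X]; omega
    · rw [coeff_sub, coeff_C_mul]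
      rcases l with _ | l
      · simp
      · rw [coeff_X_mul, coeff_derivative]; push_cast; ring
  have h1 := leg_orth hr
  rw [← hP, mul_sub, map_sub, mul_left_comm P (C _), Lint_C_mul] at h1
  have h2 := Lint_parts P (X * P)
  rw [eval_mul, eval_mul, eval_X, eval_X, derivative_mul, derivative_X, one_mul P, mul_add, map_add] at h2
  have e1 : Lint (derivative P * (X * P)) = Lint (P * (X * derivative P)) := by congr 1; ring
  have o1 := leg_one l
  have o2 := leg_neg_one_sq l
  rw [← hP] at o1 o2
  rw [e1, o1] at h2
  rw [eq_div_iff (by positivity)]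
  linear_combination (-2) * h1 + h2 + o2

lemma leg_orthogonal {l m : ℕ} (h : l ≠ m) : Lint (legendreP l * legendreP m) = 0 := by
  rcases lt_or_gt_of_ne h with h | h
  · exact leg_orth' (by rw [leg_degree]; exact_mod_cast h)
  · exact leg_orth (by rw [leg_degree]; exact_mod_cast h)

/-- the Legendre operator -/
def Lop (p : ℝ[X]) : ℝ[X] := derivative ((1 - X ^ 2) * derivative p)

lemma Lint_Lop (p q : ℝ[X]) : Lint (Lop p * q) = - Lint ((1 - X ^ 2) * derivative p * derivative q) := by
  rw [Lop, Lint_parts]; simp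

lemma Lop_symm (p q : ℝ[X]) : Lint (Lop p * q) = Lint (p * Lop q) := by
  rw [mul_comm p, Lint_Lop, Lint_Lop]; congr 2; ring

lemma Lop_coeff (p : ℝ[X]) (n : ℕ) : (Lop p).coeff n = (n + 1) * ((n + 2) * p.coeff (n + 2)  - n * p.coeff n) := by
  rw [Lop, coeff_derivative, sub_mul, one_mul, coeff_sub, coeff_derivative]
  rcases n with _ | n
  · have : (X ^ 2 * derivative p).coeff (0 + 1) = 0 := by
      rw [coeff_X_pow_mul']; simp
    rw [this]; push_cast; ring_nf
  · rw [show n + 1 + 1 = n + 2 by ring, coeff_X_pow_mul, coeff_derivative]; push_cast; ring_nf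

lemma Lop_degree_lt {p : ℝ[X]} {l : ℕ} (h : p.degree < l) : (Lop p).degree < l := by
  rw [degree_lt_iff_coeff_zero] at h ⊢
  intro m hm
  rw [Lop_coeff, h m hm, h (m + 2) (by omega)]; ring

lemma Lop_leg (l : ℕ) : Lop (legendreP l) = C (-((l:ℝ) * (l + 1))) * legendreP l := by
  have h := leg_unique (q := Lop (legendreP l)) (l := l) ?_ ?_
  · rw [h]; congr 2
    rw [Lop_coeff, coeff_eq_zero_of_natDegree_lt (show (legendreP l).natDegree < l + 2 by rw [leg_natDegree]; omega)]
    have := leg_coeff_ne l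
    field_simp; ring
  · have := Lop_degree_lt (p := legendreP l) (l := l + 1) (by rw [leg_degree]; exact_mod_cast Nat.lt_succ_self l)
    exact natDegree_le_of_degree_le (by
      rw [degree_le_iff_coeff_zero]
      rw [degree_lt_iff_coeff_zero] at this
      intro m hm
      exact this m (by exact_mod_cast hm))
  · intro r hr
    rw [Lop_symm]; exact leg_orth (Lop_degree_lt hr)

lemma leg_energy (l m : ℕ) : Lint ((1 - X ^ 2) * derivative (legendreP l) * derivative (legendreP m)) =
    if l = m then (l:ℝ) * (l + 1) * (2 / (2 * l + 1)) else 0 := by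
  have := Lint_Lop (legendreP l) (legendreP m)
  rw [Lop_leg, mul_assoc, Lint_C_mul] at this
  split_ifs with h
  · subst h; rw [leg_norm] at this; linarith
  · rw [leg_orthogonal h] at this; linarith

lemma leg_span (n : ℕ) (q : ℝ[X]) (hq : q.degree < n) :
    ∃ c : ℕ → ℝ, q = ∑ l ∈ Finset.range n, C (c l) * legendreP l := by
  induction n generalizing q with
  | zero =>
    refine ⟨0, ?_⟩
    simp only [Finset.range_zero, Finset.sum_empty]
    rw [degree_lt_iff_coeff_zero] at hq
    ext m; simp [hq m (Nat.zero_le _)]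
  | succ n ih =>
    have h1 : q.natDegree ≤ n := natDegree_le_of_degree_le (by
      rw [degree_le_iff_coeff_zero]
      rw [degree_lt_iff_coeff_zero] at hq
      intro m hm
      exact hq m (by exact_mod_cast hm))
    obtain ⟨c, hc⟩ := ih _ (sub_lead h1)
    refine ⟨fun l => if l < n then c l else q.coeff n / (legendreP n).coeff n, ?_⟩
    rw [Finset.sum_range_succ]
    simp only [lt_irrefl, if_false]
    rw [← sub_eq_iff_eq_add, hc]
    refine Finset.sum_congr rfl fun l hl => ?_
    rw [if_pos (Finset.mem_range.1 hl)]

end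
end

section
open MeasureTheory Real Metric Polynomial
open scoped ENNReal RealInnerProductSpace

noncomputable section

lemma cont_inner (x : E3) : Continuous fun z : S2 => ⟪x, (z : E3)⟫ :=
  continuous_const.inner continuous_subtype_val

lemma law_poly' (p : ℝ[X]) (y : S2) : ∫ x : S2, p.eval ⟪(y : E3), (x : E3)⟫ ∂sphereUniform = 1 / 2 * Lint p :=
  law_cont' p.continuous y

lemma int_pow_inner (w : E3) (n : ℕ) : ∫ z : S2, ⟪w, (z : E3)⟫ ^ n ∂sphereUniform =
    ‖w‖ ^ n * (1 / 2 * ∫ t in (-1:ℝ)..1, t ^ n) := by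
  by_cases hw : w = 0
  · subst hw
    rcases n with _ | n
    · simp; norm_num
    · simp
  · have hn : ‖w‖ ≠ 0 := norm_ne_zero_iff.2 hw
    let u : S2 := ⟨‖w‖⁻¹ • w, by simp [norm_smul, hn]⟩
    have h := law_cont' (g := fun t => t ^ n) (by fun_prop) u
    rw [← h, ← integral_const_mul]
    refine integral_congr_ae (Filter.Eventually.of_forall fun z => ?_)
    simp only [u, real_inner_smul_left]
    rw [← mul_pow, ← mul_assoc, mul_inv_cancel₀ hn, one_mul]

lemma coeff_deg (k : ℕ) : ∀ i, (((X ^ 2 + C (C 2 * X) * X + 1 : ℝ[X][X]) ^ k).coeff i).natDegree ≤ i := by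
  induction k with
  | zero => intro i; rw [pow_zero, coeff_one]; split_ifs <;> simp
  | succ k ih =>
    intro i
    rw [pow_succ, coeff_mul]
    refine natDegree_sum_le_of_forall_le _ _ fun p hp => ?_
    rw [Finset.HasAntidiagonal.mem_antidiagonal] at hp
    refine natDegree_mul_le.trans ?_
    have h2 : ((X ^ 2 + C (C 2 * X) * X + 1 : ℝ[X][X]).coeff p.2).natDegree ≤ p.2 := by
      rw [coeff_add, coeff_add, coeff_C_mul, coeff_X_pow, coeff_X, coeff_one]
      rcases p.2 with _ | _ | _ | n
      · simp
      · simp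
      · simp
      · simp
    have := ih p.1
    omega

lemma moment_poly (i j : ℕ) : ∃ A : ℝ[X], A.natDegree ≤ i ∧ ∀ x y : S2,
    ∫ z : S2, ⟪(x : E3), (z : E3)⟫ ^ i * ⟪(y : E3), (z : E3)⟫ ^ j ∂sphereUniform = A.eval ⟪(x : E3), (y : E3)⟫ := by
  set n := i + j with hn
  have hch : ((n.choose i : ℕ) : ℝ) ≠ 0 := by
    exact_mod_cast (Nat.choose_pos (show i ≤ n by omega)).ne'
  have gen : ∀ x y : S2, ∀ a : ℝ,
      ∑ m ∈ Finset.range (n + 1), a ^ m * (n.choose m * ∫ z : S2, ⟪(x : E3), (z : E3)⟫ ^ m * ⟪(y : E3), (z : E3)⟫ ^ (n - m) ∂sphereUniform)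
       = ‖a • (x : E3) + (y : E3)‖ ^ n * (1 / 2 * ∫ t in (-1:ℝ)..1, t ^ n) := by
    intro x y a
    rw [← int_pow_inner]
    simp only [inner_add_left, real_inner_smul_left, add_pow]
    rw [integral_finsetSum]
    · refine Finset.sum_congr rfl fun m _ => ?_
      rw [← integral_const_mul, ← integral_const_mul]
      refine integral_congr_ae (Filter.Eventually.of_forall fun z => ?_)
      simp only [mul_pow]; ring
    · intro m _
      refine integrable_sph ?_
      have := cont_inner x
      have := cont_inner y
      fun_prop
  have nsq : ∀ x y : S2, ∀ a : ℝ, ‖a • (x : E3) + (y : E3)‖ ^ 2 = a ^ 2 + 2 * ⟪(x : E3), (y : E3)⟫ * a + 1 := by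
    intro x y a
    rw [norm_add_sq_real, norm_smul, real_inner_smul_left]
    simp; ring
  -- as polynomial in a
  let G : S2 → S2 → ℝ[X] := fun x y => ∑ m ∈ Finset.range (n + 1), C (n.choose m * ∫ z : S2, ⟪(x : E3), (z : E3)⟫ ^ m * ⟪(y : E3), (z : E3)⟫ ^ (n - m) ∂sphereUniform) * X ^ m
  have Gc : ∀ x y, (G x y).coeff i = n.choose i * ∫ z : S2, ⟪(x : E3), (z : E3)⟫ ^ i * ⟪(y : E3), (z : E3)⟫ ^ j ∂sphereUniform := by
    intro x y
    simp only [G, finsetSum_coeff, coeff_C_mul, coeff_X_pow]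
    rw [Finset.sum_eq_single i]
    · simp [hn]
    · intro b _ hb; simp [hb.symm]
    · intro h; exact absurd (Finset.mem_range.2 (by omega)) h
  have Ge : ∀ x y a, (G x y).eval a = ‖a • (x : E3) + (y : E3)‖ ^ n * (1 / 2 * ∫ t in (-1:ℝ)..1, t ^ n) := by
    intro x y a
    rw [← gen x y a]
    simp only [G, eval_finsetSum, eval_mul, eval_C, eval_pow, eval_X]
    exact Finset.sum_congr rfl fun m _ => by ring
  rcases Nat.even_or_odd' n with ⟨k, hk | hk⟩
  · set κ := 1 / 2 * ∫ t in (-1:ℝ)..1, t ^ n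
    set Q : ℝ[X][X] := (X ^ 2 + C (C 2 * X) * X + 1 : ℝ[X][X]) ^ k with hQ
    refine ⟨C (κ / n.choose i) * Q.coeff i, (natDegree_C_mul_le _ _).trans (coeff_deg k i), fun x y => ?_⟩
    have : G x y = C κ * Q.map (evalRingHom ⟪(x : E3), (y : E3)⟫) := by
      refine Polynomial.funext fun a => ?_
      rw [Ge, hk, pow_mul, nsq]
      simp [hQ]; ring
    have h2 := congrArg (fun p => p.coeff i) this
    simp only [Gc, coeff_C_mul, coeff_map] at h2
    rw [eval_mul, eval_C]
    rw [coe_evalRingHom] at h2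
    field_simp
    linarith
  · refine ⟨0, by simp, fun x y => ?_⟩
    have : G x y = 0 := by
      refine Polynomial.funext fun a => ?_
      rw [Ge, integral_pow]
      have : Even (n + 1) := by rw [hk]; exact ⟨k+1, by ring⟩
      rw [this.neg_one_pow]; simp
    have h2 := Gc x y
    rw [this, coeff_zero] at h2
    rw [eval_zero]
    simpa [hch] using h2

lemma conv_poly (p q : ℝ[X]) : ∃ A : ℝ[X], A.natDegree ≤ p.natDegree ∧ ∀ x y : S2,
    ∫ z : S2, p.eval ⟪(x : E3), (z : E3)⟫ * q.eval ⟪(y : E3), (z : E3)⟫ ∂sphereUniform = A.eval ⟪(x : E3), (y : E3)⟫ := by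
  choose A hA1 hA2 using moment_poly
  refine ⟨∑ i ∈ Finset.range (p.natDegree + 1), ∑ j ∈ Finset.range (q.natDegree + 1), C (p.coeff i * q.coeff j) * A i j, ?_, ?_⟩
  · refine natDegree_sum_le_of_forall_le _ _ fun i hi => natDegree_sum_le_of_forall_le _ _ fun j hj => ?_
    refine (natDegree_C_mul_le _ _).trans ((hA1 i j).trans ?_)
    rw [Finset.mem_range] at hi; omega
  · intro x y
    have c1 := cont_inner x
    have c2 := cont_inner y
    simp only [eval_finsetSum, eval_mul, eval_C, ← hA2]
    simp only [eval_eq_sum_range, Finset.sum_mul_sum]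
    rw [integral_finsetSum]
    · refine Finset.sum_congr rfl fun i _ => ?_
      rw [integral_finsetSum]
      · refine Finset.sum_congr rfl fun j _ => ?_
        rw [← integral_const_mul]
        refine integral_congr_ae (Filter.Eventually.of_forall fun z => ?_)
        simp only; ring
      · intro j _
        exact integrable_sph (by fun_prop)
    · intro i _
      exact integrable_sph (by fun_prop)

theorem conv_leg (m : ℕ) (q : ℝ[X]) (x y : S2) :
    ∫ z : S2, (legendreP m).eval ⟪(x : E3), (z : E3)⟫ * q.eval ⟪(y : E3), (z : E3)⟫ ∂sphereUniform =
      (legendreP m).eval ⟪(x : E3), (y : E3)⟫ * (1 / 2 * Lint (legendreP m * q)) := by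
  obtain ⟨F, hF1, hF2⟩ := conv_poly (legendreP m) q
  rw [leg_natDegree] at hF1
  have h1 := leg_unique' hF1 (fun r hr => by
    obtain ⟨B, hB1, hB2⟩ := conv_poly r q
    have hB : B.degree < m ∨ r = 0 := by
      by_cases h0 : r = 0
      · exact Or.inr h0
      · left
        have h3 : r.natDegree < m := (natDegree_lt_iff_degree_lt h0).2 hr
        exact lt_of_le_of_lt degree_le_natDegree (by exact_mod_cast lt_of_le_of_lt hB1 h3)
    rcases hB with hB | hB
    swap
    · rw [hB]; simp
    have e1 := law_poly' (F * r) x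
    have e2 := law_poly' (legendreP m * B) x
    rw [leg_orth hB, mul_zero] at e2
    have : ∫ y : S2, eval ⟪(x : E3), (y : E3)⟫ (F * r) ∂sphereUniform = 0 := by
      rw [← e2]
      simp only [eval_mul, ← hF2, ← integral_mul_const]
      rw [integral_integral_swap]
      · refine integral_congr_ae (Filter.Eventually.of_forall fun z => ?_)
        simp only
        rw [← hB2, ← integral_const_mul]
        refine integral_congr_ae (Filter.Eventually.of_forall fun y => ?_)
        simp only
        rw [real_inner_comm (z : E3) (y : E3)]
        ring
      · refine Continuous.integrable_of_hasCompactSupport ?_ (HasCompactSupport.of_compactSpace _)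
        have d1 : Continuous fun p : S2 × S2 => ⟪(x : E3), (p.2 : E3)⟫ := by fun_prop
        have d2 : Continuous fun p : S2 × S2 => ⟪(p.1 : E3), (p.2 : E3)⟫ := by fun_prop
        have d3 : Continuous fun p : S2 × S2 => ⟪(x : E3), (p.1 : E3)⟫ := by fun_prop
        exact (((legendreP m).continuous.comp d1).mul (q.continuous.comp d2)).mul (r.continuous.comp d3)
    rw [this] at e1
    linarith)
  have h2 : F.eval 1 = 1 / 2 * Lint (legendreP m * q) := by
    have h3 := hF2 x x
    rw [real_inner_self_eq_norm_sq] at h3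
    have : ‖(x : E3)‖ = 1 := by simp
    rw [this, one_pow] at h3
    rw [← h3, ← law_poly' _ x]
    simp only [eval_mul]
  rw [hF2, h1, eval_mul, eval_C, h2]
  ring

theorem conv_leg_leg (l m : ℕ) (x y : S2) :
    ∫ z : S2, (legendreP l).eval ⟪(x : E3), (z : E3)⟫ * (legendreP m).eval ⟪(y : E3), (z : E3)⟫ ∂sphereUniform =
      if l = m then (legendreP l).eval ⟪(x : E3), (y : E3)⟫ / (2 * l + 1) else 0 := by
  rw [conv_leg]
  split_ifs with h
  · subst h; rw [leg_norm]; field_simp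
  · rw [leg_orthogonal h]; ring

end
end

section
open MeasureTheory Real Metric Polynomial Filter Topology
open scoped ENNReal RealInnerProductSpace

noncomputable section

/-- Legendre kernel on the sphere -/
def PP (l : ℕ) (x y : S2) : ℝ := (legendreP l).eval ⟪(x : E3), (y : E3)⟫

lemma PP_cont2 (l : ℕ) : Continuous fun p : S2 × S2 => PP l p.1 p.2 := by
  unfold PP
  have d2 : Continuous fun p : S2 × S2 => ⟪(p.1 : E3), (p.2 : E3)⟫ := by fun_prop
  exact (legendreP l).continuous.comp d2

@[fun_prop]
lemma PP_cont_comp {α : Type*} [TopologicalSpace α] (l : ℕ) {f g : α → S2} (hf : Continuous f) (hg : Continuous g) :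
    Continuous fun a => PP l (f a) (g a) := (PP_cont2 l).comp (hf.prodMk hg)

lemma PP_symm (l : ℕ) (x y : S2) : PP l x y = PP l y x := by unfold PP; rw [real_inner_comm]

lemma PP_self (l : ℕ) (x : S2) : PP l x x = 1 := by
  unfold PP
  rw [real_inner_self_eq_norm_sq]
  have : ‖(x : E3)‖ = 1 := by simp
  rw [this, one_pow, leg_one]

lemma PP_conv (l m : ℕ) (x y : S2) : ∫ z : S2, PP l x z * PP m y z ∂sphereUniform =
    if l = m then PP l x y / (2 * l + 1) else 0 := conv_leg_leg l m x y

lemma PP_conv_same (l : ℕ) (x y : S2) : ∫ z : S2, PP l x z * PP l y z ∂sphereUniform =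
    PP l x y / (2 * l + 1) := by rw [PP_conv, if_pos rfl]

lemma zonal_eq (l : ℕ) (x y : S2) : zonal l x y = (2 * l + 1) / (4 * π) * PP l x y := rfl

lemma cs_sph {f g : S2 → ℝ} (hf : Continuous f) (hg : Continuous g) :
    (∫ x, f x * g x ∂sphereUniform) ^ 2 ≤ (∫ x, f x ^ 2 ∂sphereUniform) * ∫ x, g x ^ 2 ∂sphereUniform := by
  have h := discrim_le_zero (a := ∫ x, g x ^ 2 ∂sphereUniform) (b := 2 * ∫ x, f x * g x ∂sphereUniform)
    (c := ∫ x, f x ^ 2 ∂sphereUniform) (fun t => by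
      have i1 : Integrable (fun x => f x ^ 2) sphereUniform := integrable_sph (by fun_prop)
      have i2 : Integrable (fun x => f x * g x) sphereUniform := integrable_sph (by fun_prop)
      have i3 : Integrable (fun x => g x ^ 2) sphereUniform := integrable_sph (by fun_prop)
      have : ∫ x, (f x + t * g x) ^ 2 ∂sphereUniform = (∫ x, g x ^ 2 ∂sphereUniform) * (t * t) + 2 * (∫ x, f x * g x ∂sphereUniform) * t
          + ∫ x, f x ^ 2 ∂sphereUniform := by
        have e : ∀ x, (f x + t * g x) ^ 2 = (t * t) * g x ^ 2 + (2 * t) * (f x * g x) + f x ^ 2 := fun x => by ring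
        simp_rw [e]
        have i4 : Integrable (fun x => (t * t) * g x ^ 2 + (2 * t) * (f x * g x)) sphereUniform :=
          (i3.const_mul _).add (i2.const_mul _)
        rw [integral_add i4 i1, integral_add (i3.const_mul _) (i2.const_mul _),
          integral_const_mul, integral_const_mul]
        ring
      rw [← this]
      exact integral_nonneg fun x => sq_nonneg _)
  rw [discrim] at h
  nlinarith

lemma PP_abs_le (l : ℕ) (x y : S2) : |PP l x y| ≤ 1 := by
  have h := cs_sph (f := fun z => PP l x z) (g := fun z => PP l y z) (by fun_prop) (by fun_prop)
  simp only [pow_two (PP l _ _)] at h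
  rw [PP_conv_same, PP_conv_same, PP_conv_same, PP_self, PP_self, div_pow, div_mul_div_comm, one_mul, ← pow_two] at h
  have hp : (0:ℝ) < (2 * l + 1) ^ 2 := by positivity
  rw [div_le_div_iff_of_pos_right hp] at h
  exact (sq_le_one_iff_abs_le_one _).1 h

/-- degree-`l` projection (up to the factor `2l+1`) -/
def pr (l : ℕ) (f : S2 → ℝ) (x : S2) : ℝ := ∫ y, PP l x y * f y ∂sphereUniform

lemma int_prod_sph {f : S2 × S2 → ℝ} (hf : Continuous f) : Integrable f (sphereUniform.prod sphereUniform) :=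
  hf.integrable_of_hasCompactSupport (HasCompactSupport.of_compactSpace _)

lemma pr_cont (l : ℕ) {f : S2 → ℝ} (hf : Continuous f) : Continuous (pr l f) := by
  unfold pr
  have : Continuous (Function.uncurry fun x y => PP l x y * f y) := by
    have h2 : Continuous fun p : S2 × S2 => PP l p.1 p.2 * f p.2 := by fun_prop
    exact h2
  have := continuous_parametric_integral_of_continuous (μ := sphereUniform) this isCompact_univ
  simpa using this

/-- projections compose -/
lemma pr_pr (l m : ℕ) {f : S2 → ℝ} (hf : Continuous f) (x : S2) :
    pr m (pr l f) x = if m = l then pr l f x / (2 * l + 1) else 0 := by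
  unfold pr
  simp_rw [← integral_const_mul]
  rw [integral_integral_swap]
  · have : ∀ w, ∫ y, PP m x y * (PP l y w * f w) ∂sphereUniform = (if m = l then PP m x w / (2 * m + 1) else 0) * f w := by
      intro w
      rw [← PP_conv, ← integral_mul_const]
      congr 1; ext y; rw [PP_symm l y w]; ring
    simp_rw [this]
    split_ifs with h
    · subst h
      rw [← integral_div]; congr 1; ext w; ring
    · simp
  · exact int_prod_sph (f := fun p => PP m x p.1 * (PP l p.1 p.2 * f p.2)) (by fun_prop)

lemma pr_sq (l : ℕ) {f : S2 → ℝ} (hf : Continuous f) :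
    ∫ x, pr l f x ^ 2 ∂sphereUniform = (∫ x, f x * pr l f x ∂sphereUniform) / (2 * l + 1) := by
  have hc := pr_cont l hf
  have h1 : ∫ x, pr l f x ^ 2 ∂sphereUniform = ∫ x, ∫ y, f y * PP l x y * pr l f x ∂sphereUniform ∂sphereUniform := by
    congr 1; ext x
    rw [pow_two]
    have : pr l f x * pr l f x = (∫ y, PP l x y * f y ∂sphereUniform) * pr l f x := rfl
    rw [this, ← integral_mul_const]
    congr 1; ext y; ring
  rw [h1, integral_integral_swap, ← integral_div]
  · congr 1; ext y
    have := pr_pr l l hf y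
    rw [if_pos rfl] at this
    rw [mul_div_assoc, ← this]
    conv_rhs => rw [pr]
    rw [← integral_const_mul]
    congr 1; ext x; rw [PP_symm]; ring
  · exact int_prod_sph (f := fun p => f p.2 * PP l p.1 p.2 * pr l f p.1) (by fun_prop)

lemma levelSq_eq (l : ℕ) {f : S2 → ℝ} (hf : Continuous f) :
    levelSq l f = 4 * π * (2 * l + 1) ^ 2 * ∫ x, pr l f x ^ 2 ∂sphereUniform := by
  rw [pr_sq l hf, levelSq]
  simp_rw [integral_area, smul_eq_mul, zonal_eq]
  have : ∀ x, ∫ y, f x * ((2 * l + 1) / (4 * π) * PP l x y) * f y ∂sphereUniform = (2 * l + 1) / (4 * π) * (f x * pr l f x) := by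
    intro x
    rw [pr, ← integral_const_mul, ← integral_const_mul]
    congr 1; ext y; ring
  simp_rw [this]
  rw [integral_const_mul, integral_const_mul]
  have : π ≠ 0 := pi_ne_zero
  field_simp

lemma levelSq_nonneg (l : ℕ) {f : S2 → ℝ} (hf : Continuous f) : 0 ≤ levelSq l f := by
  rw [levelSq_eq l hf]
  have : 0 ≤ ∫ x, pr l f x ^ 2 ∂sphereUniform := integral_nonneg fun x => sq_nonneg _
  positivity

/-- the `S_l` statistic -/
def SS {N : ℕ} (l : ℕ) (x : Fin N → S2) : ℝ := ∑ i, ∑ j, zonal l (x i) (x j)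

lemma SS_eq {N : ℕ} (l : ℕ) (x : Fin N → S2) :
    SS l x = (2 * l + 1) ^ 2 / (4 * π) * ∫ z, (∑ i, PP l (x i) z) ^ 2 ∂sphereUniform := by
  have : ∫ z, (∑ i, PP l (x i) z) ^ 2 ∂sphereUniform = ∑ i, ∑ j, PP l (x i) (x j) / (2 * l + 1) := by
    simp_rw [pow_two, Finset.sum_mul_sum]
    rw [integral_finsetSum _ fun i _ => integrable_sph (by fun_prop)]
    refine Finset.sum_congr rfl fun i _ => ?_
    rw [integral_finsetSum _ fun j _ => integrable_sph (by fun_prop)]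
    exact Finset.sum_congr rfl fun j _ => PP_conv_same _ _ _
  rw [this, SS, Finset.mul_sum]
  refine Finset.sum_congr rfl fun i _ => ?_
  rw [Finset.mul_sum]
  refine Finset.sum_congr rfl fun j _ => ?_
  rw [zonal_eq]
  have : π ≠ 0 := pi_ne_zero
  field_simp

lemma SS_nonneg {N : ℕ} (l : ℕ) (x : Fin N → S2) : 0 ≤ SS l x := by
  rw [SS_eq]
  have : 0 ≤ ∫ z, (∑ i, PP l (x i) z) ^ 2 ∂sphereUniform := integral_nonneg fun x => sq_nonneg _
  positivity

lemma SS_le {N : ℕ} (l : ℕ) (x : Fin N → S2) : SS l x ≤ (2 * l + 1) / (4 * π) * N ^ 2 := by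
  have : SS l x ≤ ∑ i : Fin N, ∑ j : Fin N, ((2 * l + 1) / (4 * π) : ℝ) := by
    refine Finset.sum_le_sum fun i _ => Finset.sum_le_sum fun j _ => ?_
    rw [zonal_eq]
    refine mul_le_of_le_one_right (by positivity) ((le_abs_self _).trans (PP_abs_le _ _ _))
  refine this.trans (le_of_eq ?_)
  simp; ring

lemma sum_pr_sq_le {N : ℕ} (l : ℕ) (x : Fin N → S2) {f : S2 → ℝ} (hf : Continuous f) :
    (∑ i, (2 * l + 1) * pr l f (x i)) ^ 2 ≤ SS l x * levelSq l f := by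
  have hc := pr_cont l hf
  have h1 : ∑ i, (2 * l + 1) * pr l f (x i) = (2 * l + 1) ^ 2 * ∫ z, (∑ i, PP l (x i) z) * pr l f z ∂sphereUniform := by
    simp_rw [Finset.sum_mul]
    rw [integral_finsetSum _ fun i _ => integrable_sph (by fun_prop), Finset.mul_sum]
    refine Finset.sum_congr rfl fun i _ => ?_
    have := pr_pr l l hf (x i)
    rw [if_pos rfl, pr] at this
    rw [this]
    field_simp
  have h2 := cs_sph (f := fun z => ∑ i, PP l (x i) z) (g := pr l f) (by fun_prop) hc
  rw [h1, SS_eq, levelSq_eq l hf, mul_pow]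
  have : π ≠ 0 := pi_ne_zero
  calc _ ≤ ((2 * l + 1 : ℝ) ^ 2) ^ 2 * ((∫ z, (∑ i, PP l (x i) z) ^ 2 ∂sphereUniform) * ∫ z, pr l f z ^ 2 ∂sphereUniform) := by gcongr
    _ = _ := by field_simp

lemma pr_poly_zero {F : S2 → ℝ} (hF : Continuous F) (h0 : ∀ l x, pr l F x = 0) (q : ℝ[X]) (x : S2) :
    ∫ y, q.eval ⟪(x : E3), (y : E3)⟫ * F y ∂sphereUniform = 0 := by
  obtain ⟨c, hc⟩ := leg_span (q.natDegree + 1) q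
    (lt_of_le_of_lt degree_le_natDegree (by exact_mod_cast Nat.lt_succ_self _))
  have e : ∀ y : S2, q.eval ⟪(x : E3), (y : E3)⟫ * F y = ∑ l ∈ Finset.range (q.natDegree + 1), c l * (PP l x y * F y) := by
    intro y
    conv_lhs => rw [hc]
    rw [eval_finsetSum, Finset.sum_mul]
    refine Finset.sum_congr rfl fun l _ => ?_
    rw [eval_mul, eval_C, PP]; ring
  simp_rw [e]
  rw [integral_finsetSum _ fun i _ => integrable_sph (by fun_prop)]
  refine Finset.sum_eq_zero fun l _ => ?_
  rw [integral_const_mul]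
  have := h0 l x
  rw [pr] at this
  rw [this, mul_zero]

instance : Nonempty S2 := ⟨pole⟩

instance : sphereUniform.IsOpenPosMeasure := by
  constructor
  intro U hU hne
  rw [sphereUniform, Measure.smul_apply, smul_eq_mul]
  refine mul_ne_zero (ENNReal.inv_ne_zero.2 ENNReal.ofReal_ne_top) (hU.measure_ne_zero _ hne)

lemma complete_sph {F : S2 → ℝ} (hF : Continuous F) (h0 : ∀ l x, pr l F x = 0) (x : S2) : F x = 0 := by
  have cx := cont_inner (x : E3)
  have h := tendsto_setIntegral_pow_smul_of_unique_maximum_of_isCompact_of_continuousOn (μ := sphereUniform)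
    (s := Set.univ) (x₀ := x) (g := F) (c := fun y : S2 => (1 + ⟪(x : E3), (y : E3)⟫) / 2) isCompact_univ
    (by fun_prop) (fun y _ hy => ?_) (fun y _ => ?_) ?_ (by simp) hF.continuousOn
  · have e : ∀ n : ℕ, ∫ y in Set.univ, ((1 + ⟪(x : E3), (y : E3)⟫) / 2) ^ n • F y ∂sphereUniform = 0 := by
      intro n
      have := pr_poly_zero hF h0 ((C (1/2) * (1 + X)) ^ n) x
      rw [Measure.restrict_univ, ← this]
      congr 1; ext y
      simp only [eval_pow, eval_mul, eval_C, eval_add, eval_one, eval_X, smul_eq_mul]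
      congr 2; ring
    simp_rw [e, smul_zero] at h
    exact (tendsto_nhds_unique h tendsto_const_nhds)
  · have hx : ‖(x : E3)‖ = 1 := by simp
    have hy' : ‖(y : E3)‖ = 1 := by simp
    have h1 := inner_lt_one_iff_real_of_norm_eq_one hy' hx
    have h2 : ⟪(y : E3), (x : E3)⟫ < 1 := h1.2 (fun h => hy (Subtype.ext h))
    have h3 : ⟪(x : E3), (x : E3)⟫ = 1 := by rw [real_inner_self_eq_norm_sq, hx]; norm_num
    rw [h3, real_inner_comm]; linarith
  · have := abs_real_inner_le_norm (x : E3) (y : E3)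
    have hx : ‖(x : E3)‖ = 1 := by simp
    have hy' : ‖(y : E3)‖ = 1 := by simp
    rw [hx, hy', one_mul] at this
    linarith [(abs_le.1 this).1]
  · have hx : ‖(x : E3)‖ = 1 := by simp
    rw [real_inner_self_eq_norm_sq, hx]; norm_num

end
end

section
open MeasureTheory Real Metric Polynomial Filter Topology
open scoped ENNReal RealInnerProductSpace Manifold

noncomputable section

/-- eigenvalue of degree `l+1` -/
def lam (l : ℕ) : ℝ := ((l : ℝ) + 1) * (l + 2)

lemma lam_pos (l : ℕ) : 0 < lam l := by unfold lam; positivity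

lemma tele (l : ℕ) : (2 * ((l + 1 : ℕ) : ℝ) + 1) / lam l ^ 2 = 1 / ((l:ℝ) + 1) ^ 2 - 1 / ((l:ℝ) + 2) ^ 2 := by
  unfold lam
  have : (l:ℝ) + 1 ≠ 0 := by positivity
  have : (l:ℝ) + 2 ≠ 0 := by positivity
  push_cast
  field_simp; ring

lemma sum_coef : Summable fun l : ℕ => (2 * ((l + 1 : ℕ) : ℝ) + 1) / (4 * π) / lam l ^ 2 := by
  have h1 : Summable fun l : ℕ => 1 / ((l:ℝ) + 1) ^ 2 := by
    have := (summable_nat_add_iff 1).2 (Real.summable_one_div_nat_pow.2 (one_lt_two))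
    simpa using this
  refine Summable.of_nonneg_of_le (fun l => by have := lam_pos l; positivity) (fun l => ?_) h1
  rw [div_right_comm, tele]
  have h2 : 0 ≤ 1 / ((l:ℝ) + 1) ^ 2 := by positivity
  have h3 : 0 ≤ 1 / ((l:ℝ) + 2) ^ 2 := by positivity
  have h4 : 1 ≤ 4 * π := by linarith [pi_gt_three]
  rw [div_le_iff₀ (by positivity)]
  nlinarith

/-- pointwise bound -/
lemma fl_bound {f : S2 → ℝ} (hf : Continuous f) (l : ℕ) (x : S2) :
    |(2 * ((l + 1 : ℕ) : ℝ) + 1) * pr (l + 1) f x| ≤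
      (2 * ((l + 1 : ℕ) : ℝ) + 1) / (4 * π) / lam l ^ 2 + lam l ^ 2 * levelSq (l + 1) f := by
  have h := sum_pr_sq_le (N := 1) (l + 1) (fun _ => x) hf
  simp only [Finset.univ_unique, Finset.sum_singleton] at h
  have hS : SS (N := 1) (l + 1) (fun _ => x) = (2 * ((l + 1 : ℕ) : ℝ) + 1) / (4 * π) := by
    simp [SS, zonal_eq, PP_self]
  rw [hS] at h
  have hl := levelSq_nonneg (l + 1) hf
  have hlam := lam_pos l
  have hA : 0 ≤ (2 * ((l + 1 : ℕ) : ℝ) + 1) / (4 * π) / lam l ^ 2 := by positivity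
  have hB : 0 ≤ lam l ^ 2 * levelSq (l + 1) f := by positivity
  refine abs_le_of_sq_le_sq ?_ (by positivity)
  have e : (2 * ((l + 1 : ℕ) : ℝ) + 1) / (4 * π) * levelSq (l + 1) f =
    (2 * ((l + 1 : ℕ) : ℝ) + 1) / (4 * π) / lam l ^ 2 * (lam l ^ 2 * levelSq (l + 1) f) := by field_simp
  rw [e] at h
  nlinarith [mul_nonneg hA hB]

lemma PP_zero (x y : S2) : PP 0 x y = 1 := by simp [PP, legendreP]

lemma pr_zero (f : S2 → ℝ) (x : S2) : pr 0 f x = ∫ y, f y ∂sphereUniform := by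
  simp [pr, PP_zero]

lemma expansion {f : S2 → ℝ} (hf : Continuous f) (hs : Summable fun l => lam l ^ 2 * levelSq (l + 1) f) (x : S2) :
    HasSum (fun l : ℕ => (2 * ((l + 1 : ℕ) : ℝ) + 1) * pr (l + 1) f x) (f x - ∫ y, f y ∂sphereUniform) := by
  have hb : Summable fun l : ℕ => (2 * ((l + 1 : ℕ) : ℝ) + 1) / (4 * π) / lam l ^ 2 + lam l ^ 2 * levelSq (l + 1) f :=
    sum_coef.add hs
  have hc : ∀ l, Continuous (pr l f) := fun l => pr_cont l hf
  set G : S2 → ℝ := fun x => ∑' l : ℕ, (2 * ((l + 1 : ℕ) : ℝ) + 1) * pr (l + 1) f x with hG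
  have hGc : Continuous G := by
    refine continuous_tsum (fun l => by have := hc (l+1); fun_prop) hb fun l x => ?_
    rw [Real.norm_eq_abs]; exact fl_bound hf l x
  have hsx : ∀ x, HasSum (fun l : ℕ => (2 * ((l + 1 : ℕ) : ℝ) + 1) * pr (l + 1) f x) (G x) := by
    intro x
    refine Summable.hasSum (Summable.of_norm_bounded hb fun l => ?_)
    rw [Real.norm_eq_abs]; exact fl_bound hf l x
  have prG : ∀ m x, pr m G x = if m = 0 then 0 else pr m f x := by
    intro m x
    have hh := hasSum_integral_of_summable_integral_norm (μ := sphereUniform)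
      (F := fun (l : ℕ) y => PP m x y * ((2 * ((l + 1 : ℕ) : ℝ) + 1) * pr (l + 1) f y))
      (fun l => integrable_sph (by have := hc (l+1); fun_prop)) (by
        refine Summable.of_nonneg_of_le (fun l => integral_nonneg fun y => norm_nonneg _) (fun l => ?_) hb
        have hcl := hc (l+1)
        have : ∫ y, ‖PP m x y * ((2 * ((l + 1 : ℕ) : ℝ) + 1) * pr (l + 1) f y)‖ ∂sphereUniform ≤
            ∫ y, ((2 * ((l + 1 : ℕ) : ℝ) + 1) / (4 * π) / lam l ^ 2 + lam l ^ 2 * levelSq (l + 1) f) ∂sphereUniform := by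
          refine integral_mono (integrable_sph (by fun_prop)) (integrable_const _) fun y => ?_
          simp only
          rw [norm_mul, Real.norm_eq_abs, Real.norm_eq_abs]
          calc _ ≤ 1 * |(2 * ((l + 1 : ℕ) : ℝ) + 1) * pr (l + 1) f y| := by gcongr; exact PP_abs_le _ _ _
            _ ≤ _ := by rw [one_mul]; exact fl_bound hf l y
        simpa using this)
    have e1 : ∀ l : ℕ, ∫ y, PP m x y * ((2 * ((l + 1 : ℕ) : ℝ) + 1) * pr (l + 1) f y) ∂sphereUniform =
        if m = l + 1 then pr m f x else 0 := by
      intro l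
      have := pr_pr (l+1) m hf x
      rw [pr] at this
      simp_rw [mul_left_comm (PP m x _)]
      rw [integral_const_mul, this]
      split_ifs with h
      · subst h; field_simp
      · simp
    simp_rw [e1] at hh
    have e2 : ∫ y, ∑' l : ℕ, PP m x y * ((2 * ((l + 1 : ℕ) : ℝ) + 1) * pr (l + 1) f y) ∂sphereUniform = pr m G x := by
      rw [pr]; congr 1; ext y; rw [tsum_mul_left]
    rw [e2] at hh
    refine hh.unique ?_
    rcases m with _ | m
    · simp
    · have := hasSum_ite_eq (α := ℝ) m (pr (m+1) f x)
      simp only [Nat.succ_ne_zero, if_false]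
      refine this.congr_fun ?_ |> id
      intro l
      by_cases h : l = m
      · simp [h]
      · have : ¬ (m + 1 = l + 1) := by omega
        rw [if_neg this, if_neg h]
  have key := complete_sph (F := fun x => f x - pr 0 f x - G x)
    (by have := hc 0; fun_prop) (fun m x => by
      have i0 := hc 0
      have : pr m (fun x => f x - pr 0 f x - G x) x = pr m f x - pr m (pr 0 f) x - pr m G x := by
        unfold pr at *
        simp_rw [mul_sub]
        have k1 : Integrable (fun y => PP m x y * f y) sphereUniform := integrable_sph (by fun_prop)
        have k2 : Integrable (fun y => PP m x y * ∫ w, PP 0 y w * f w ∂sphereUniform) sphereUniform :=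
          integrable_sph (by fun_prop)
        have k3 : Integrable (fun y => PP m x y * G y) sphereUniform := integrable_sph (by fun_prop)
        have k4 : Integrable (fun y => PP m x y * f y - PP m x y * ∫ w, PP 0 y w * f w ∂sphereUniform) sphereUniform := k1.sub k2
        rw [integral_sub k4 k3, integral_sub k1 k2]
      rw [this, pr_pr 0 m hf, prG]
      split_ifs with h
      · subst h; simp
      · ring) x
  have := hsx x
  rw [pr_zero] at key
  convert! this using 1
  linarith

lemma err_bound {N : ℕ} (x : Fin N → S2) {B : ℝ}
    (hB : ∀ n, ∑ l ∈ Finset.range n, SS (l + 1) x / lam l ^ 2 ≤ B)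
    {f : S2 → ℝ} (hf : Continuous f) (hs : Summable fun l => lam l ^ 2 * levelSq (l + 1) f)
    (h1 : ∑' l, lam l ^ 2 * levelSq (l + 1) f ≤ 1) :
    |∑ i, (f (x i) - ∫ y, f y ∂sphereUniform)| ≤ √B := by
  have hsum := hasSum_sum (s := (Finset.univ : Finset (Fin N))) fun i _ => expansion hf hs (x i)
  have hB0 : 0 ≤ B := by simpa using hB 0
  refine le_of_tendsto (hsum.tendsto_sum_nat.abs) (Eventually.of_forall fun n => ?_)
  refine abs_le_of_sq_le_sq ?_ (sqrt_nonneg _)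
  rw [Real.sq_sqrt hB0]
  set u : ℕ → ℝ := fun l => ∑ i, (2 * ((l + 1 : ℕ) : ℝ) + 1) * pr (l + 1) f (x i) with hu
  have hul : ∀ l, u l ^ 2 ≤ SS (l + 1) x * levelSq (l + 1) f := fun l => sum_pr_sq_le (l + 1) x hf
  have cs := Finset.sum_sq_le_sum_mul_sum_of_sq_le_mul (Finset.range n) (r := u) (f := fun l => SS (l + 1) x / lam l ^ 2)
    (g := fun l => lam l ^ 2 * levelSq (l + 1) f)
    (fun l _ => div_nonneg (SS_nonneg _ _) (by positivity)) (fun l _ => mul_nonneg (by positivity) (levelSq_nonneg _ hf))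
    (fun l _ => by
      have := lam_pos l
      refine (hul l).trans (le_of_eq ?_)
      field_simp)
  refine cs.trans ?_
  have h2 : ∑ l ∈ Finset.range n, lam l ^ 2 * levelSq (l + 1) f ≤ 1 :=
    (hs.sum_le_tsum _ fun l _ => mul_nonneg (by positivity) (levelSq_nonneg _ hf)).trans h1
  have h3 : 0 ≤ ∑ l ∈ Finset.range n, lam l ^ 2 * levelSq (l + 1) f :=
    Finset.sum_nonneg fun l _ => mul_nonneg (by positivity) (levelSq_nonneg _ hf)
  calc _ ≤ B * 1 := mul_le_mul (hB n) h2 h3 hB0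
    _ = B := mul_one B

lemma lam_rpow (l : ℕ) : (((l + 1) * (l + 2) : ℕ) : ℝ) ^ (2:ℝ) = lam l ^ 2 := by
  rw [Real.rpow_two]; unfold lam; push_cast; ring

lemma sob_eq (f : S2 → ℝ) : sobNormSq 2 f = ∑' l, lam l ^ 2 * levelSq (l + 1) f := by
  unfold sobNormSq
  simp_rw [lam_rpow]

lemma levelSq_smul (l : ℕ) (c : ℝ) (f : S2 → ℝ) : levelSq l (fun x => c * f x) = c ^ 2 * levelSq l f := by
  unfold levelSq
  have : ∀ x y, c * f x * zonal l x y * (c * f y) = c ^ 2 * (f x * zonal l x y * f y) := fun x y => by ring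
  simp_rw [this, integral_const_mul]

lemma wce_le {N : ℕ} (hN : 1 ≤ N) (x : Fin N → S2) {B : ℝ}
    (hB : ∀ n, ∑ l ∈ Finset.range n, SS (l + 1) x / lam l ^ 2 ≤ B) : wce N 2 x ≤ √B / N := by
  have hN0 : (0:ℝ) < N := by exact_mod_cast hN
  have hR : 0 ≤ √B / N := by positivity
  unfold wce
  by_cases hall : ∀ f : S2 → ℝ, SmoothOnSphere f → sobNormSq 2 f ≤ 1 →
      ¬ Summable (fun l => lam l ^ 2 * levelSq (l + 1) f) →
      |(∫ y, f y ∂sphereUniform) - (1 / N : ℝ) * ∑ i, f (x i)| = 0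
  · refine Real.sSup_le ?_ hR
    rintro r ⟨f, hf, hf1, rfl⟩
    by_cases hs : Summable (fun l => lam l ^ 2 * levelSq (l + 1) f)
    · rw [sob_eq] at hf1
      have hfc : Continuous f := ContMDiff.continuous hf
      have := err_bound x hB hfc hs hf1
      rw [Finset.sum_sub_distrib, Finset.sum_const, Finset.card_univ, Fintype.card_fin, nsmul_eq_mul] at this
      have e : (∫ y, f y ∂sphereUniform) - (1 / N : ℝ) * ∑ i, f (x i) =
        - (∑ i, f (x i) - N * ∫ y, f y ∂sphereUniform) / N := by field_simp; ring
      rw [e, abs_div, abs_neg, abs_of_pos hN0]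
      gcongr
    · rw [hall f hf hf1 hs]; exact hR
  · push Not at hall
    obtain ⟨f, hf, hf1, hs, hne⟩ := hall
    set r := |(∫ y, f y ∂sphereUniform) - (1 / N : ℝ) * ∑ i, f (x i)| with hr
    have hr0 : 0 < r := lt_of_le_of_ne (abs_nonneg _) (Ne.symm hne)
    rw [Real.sSup_of_not_bddAbove]
    · exact hR
    · rintro ⟨A, hA⟩
      have hmem : ∀ c : ℝ, 0 < c → c * r ≤ A := by
        intro c hc
        refine hA ⟨fun x => c * f x, ?_, ?_, ?_⟩
        · exact (contMDiff_const.mul hf)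
        · rw [sob_eq, tsum_eq_zero_of_not_summable]
          · exact zero_le_one
          · simp_rw [levelSq_smul, mul_left_comm (lam _ ^ 2)]
            rw [summable_mul_left_iff (by positivity)]
            exact hs
        · rw [integral_const_mul, ← Finset.mul_sum, hr]
          rw [mul_left_comm, ← mul_sub, abs_mul, abs_of_pos hc]
      have h1 := hmem ((|A| + 1) / r) (by positivity)
      rw [div_mul_cancel₀ _ hr0.ne'] at h1
      linarith [le_abs_self A]

/-- truncated energy -/
def YY {N : ℕ} (x : Fin N → S2) : ℝ := ∑ l ∈ Finset.range N, SS (l + 1) x / lam l ^ 2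

lemma YY_nonneg {N : ℕ} (x : Fin N → S2) : 0 ≤ YY x :=
  Finset.sum_nonneg fun l _ => div_nonneg (SS_nonneg _ _) (by positivity)

theorem wce_le_YY {N : ℕ} (hN : 1 ≤ N) (x : Fin N → S2) : wce N 2 x ≤ √(YY x + 1) / N := by
  refine wce_le hN x fun n => ?_
  have hN0 : (0:ℝ) < N := by exact_mod_cast hN
  have hp : 0 < 4 * π := by positivity
  have main : ∀ k, ∑ l ∈ Finset.range (N + k), SS (l + 1) x / lam l ^ 2 ≤
      YY x + N ^ 2 / (4 * π) * (1 / ((N:ℝ) + 1) ^ 2 - 1 / ((N:ℝ) + k + 1) ^ 2) := by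
    intro k
    induction k with
    | zero => simp [YY]
    | succ k ih =>
      rw [← add_assoc, Finset.sum_range_succ]
      have h1 : SS (N + k + 1) x / lam (N + k) ^ 2 ≤ N ^ 2 / (4 * π) * (1 / ((N:ℝ) + k + 1) ^ 2 - 1 / ((N:ℝ) + k + 2) ^ 2) := by
        have t := tele (N + k)
        push_cast at t
        rw [← t]
        have := SS_le (N + k + 1) x
        calc SS (N + k + 1) x / lam (N + k) ^ 2 ≤ ((2 * ((N + k + 1 : ℕ):ℝ) + 1) / (4 * π) * N ^ 2) / lam (N + k) ^ 2 := by
              gcongr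
          _ = _ := by push_cast; ring
      push_cast
      rw [show (N:ℝ) + (k + 1) + 1 = N + k + 2 by ring]
      nlinarith
  have hk : ∃ k, n ≤ N + k := ⟨n, by omega⟩
  obtain ⟨k, hk⟩ := hk
  have h1 : ∑ l ∈ Finset.range n, SS (l + 1) x / lam l ^ 2 ≤ ∑ l ∈ Finset.range (N + k), SS (l + 1) x / lam l ^ 2 :=
    Finset.sum_le_sum_of_subset_of_nonneg (Finset.range_subset_range.2 hk) fun l _ _ => div_nonneg (SS_nonneg _ _) (by positivity)
  refine h1.trans ((main k).trans ?_)
  have h2 : N ^ 2 / (4 * π) * (1 / ((N:ℝ) + 1) ^ 2 - 1 / ((N:ℝ) + k + 1) ^ 2) ≤ 1 := by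
    have h3 : 0 ≤ 1 / ((N:ℝ) + k + 1) ^ 2 := by positivity
    calc _ ≤ N ^ 2 / (4 * π) * (1 / ((N:ℝ) + 1) ^ 2) := by gcongr; linarith
      _ ≤ 1 := by
        rw [div_mul_div_comm, div_le_one (by positivity), mul_one]
        have : 1 ≤ 4 * π := by linarith [pi_gt_three]
        nlinarith
  linarith

end
end

section
open MeasureTheory Real
open scoped RealInnerProductSpace ComplexConjugate

noncomputable section

/-- rotation about the third axis, as a linear map -/
def axLin (a : ℝ) : E3 →ₗ[ℝ] E3 where
  toFun x := !₂[cos a * x 0 - sin a * x 1, sin a * x 0 + cos a * x 1, x 2]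
  map_add' x y := by
    ext i; fin_cases i <;> simp <;> ring
  map_smul' c x := by
    ext i; fin_cases i <;> simp <;> ring

def axRot (a : ℝ) : E3 ≃ₗᵢ[ℝ] E3 :=
  LinearIsometry.toLinearIsometryEquiv (⟨axLin a, fun x => by
    rw [EuclideanSpace.norm_eq, EuclideanSpace.norm_eq]
    congr 1
    simp [Fin.sum_univ_three, axLin]
    linear_combination (x 0 ^ 2 + x 1 ^ 2) * sin_sq_add_cos_sq a⟩ : E3 →ₗᵢ[ℝ] E3) rfl

lemma axRot_apply (a : ℝ) (x : E3) :
    axRot a x = !₂[cos a * x 0 - sin a * x 1, sin a * x 0 + cos a * x 1, x 2] := rfl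

def uu (x : S2) : ℂ := (√(1 + (x : E3) 2) : ℝ)
def vv (x : S2) : ℂ := if (x : E3) 2 = -1 then (√2 : ℝ) else
  ((x : E3) 0 + (x : E3) 1 * Complex.I) / (√(1 + (x : E3) 2) : ℝ)

lemma uu_meas : Measurable uu := by
  unfold uu
  have : Continuous fun x : S2 => ((√(1 + (x : E3) 2) : ℝ) : ℂ) := by fun_prop
  exact this.measurable

lemma vv_meas : Measurable vv := by
  unfold vv
  have h0 : Continuous fun x : S2 => (x : E3) 2 := by fun_prop
  have h1 : Continuous fun x : S2 => (((x : E3) 0 : ℂ) + (x : E3) 1 * Complex.I) := by fun_prop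
  refine Measurable.ite (h0.measurable (measurableSet_singleton _)) measurable_const ?_
  exact h1.measurable.div uu_meas

lemma one_add_nonneg (x : S2) : 0 ≤ 1 + (x : E3) 2 := by linarith [(coord_mem x).1]

lemma uu_sq (x : S2) : uu x * conj (uu x) = ((1 + (x : E3) 2 : ℝ) : ℂ) := by
  unfold uu
  rw [Complex.conj_ofReal, ← Complex.ofReal_mul, Real.mul_self_sqrt (one_add_nonneg x)]

lemma vv_sq (x : S2) : vv x * conj (vv x) = ((1 - (x : E3) 2 : ℝ) : ℂ) := by
  unfold vv
  split_ifs with h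
  · rw [Complex.conj_ofReal, ← Complex.ofReal_mul, Real.mul_self_sqrt (by norm_num), h]; norm_num
  · have hp : 0 < 1 + (x : E3) 2 := lt_of_le_of_ne (one_add_nonneg x) (fun e => h (by linarith))
    rw [map_div₀, Complex.conj_ofReal, div_mul_div_comm, ← Complex.ofReal_mul, Real.mul_self_sqrt hp.le,
      div_eq_iff (by exact_mod_cast hp.ne')]
    simp only [map_add, map_mul, Complex.conj_ofReal, Complex.conj_I]
    have h3 : ((x : E3) 0 : ℂ) ^ 2 + ((x : E3) 1 : ℂ) ^ 2 + ((x : E3) 2 : ℂ) ^ 2 = 1 := by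
      have := congrArg (fun r : ℝ => (r : ℂ)) (sph_sq x)
      simpa using this
    push_cast
    linear_combination h3 - ((x : E3) 1 : ℂ) ^ 2 * Complex.I_sq

lemma dist_sq' (x y : S2) : dist x y ^ 2 = 2 - 2 * ((x : E3) 0 * (y : E3) 0 + (x : E3) 1 * (y : E3) 1 + (x : E3) 2 * (y : E3) 2) := by
  rw [Subtype.dist_eq, EuclideanSpace.dist_eq, Real.sq_sqrt (by positivity)]
  simp only [Fin.sum_univ_three, Real.dist_eq, sq_abs]
  linear_combination sph_sq x + sph_sq y

lemma uv_dist (x y : S2) : (vv y * uu x - vv x * uu y) * conj (vv y * uu x - vv x * uu y) =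
    ((dist x y ^ 2 : ℝ) : ℂ) := by
  have key : vv y * conj (vv x) * (uu x * conj (uu y)) + conj (vv y) * vv x * (conj (uu x) * uu y) =
      ((2 * ((x : E3) 0 * (y : E3) 0 + (x : E3) 1 * (y : E3) 1) : ℝ) : ℂ) := by
    by_cases hx : (x : E3) 2 = -1
    · have h := sph_sq x
      have h0 : (x : E3) 0 = 0 := by rw [hx] at h; nlinarith
      have h1 : (x : E3) 1 = 0 := by rw [hx] at h; nlinarith
      simp [uu, hx, h0, h1]
    by_cases hy : (y : E3) 2 = -1
    · have h := sph_sq y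
      have h0 : (y : E3) 0 = 0 := by rw [hy] at h; nlinarith
      have h1 : (y : E3) 1 = 0 := by rw [hy] at h; nlinarith
      simp [uu, hy, h0, h1]
    have hpx : 0 < 1 + (x : E3) 2 := lt_of_le_of_ne (one_add_nonneg x) (fun e => hx (by linarith))
    have hpy : 0 < 1 + (y : E3) 2 := lt_of_le_of_ne (one_add_nonneg y) (fun e => hy (by linarith))
    have ex : ((√(1 + (x : E3) 2) : ℝ) : ℂ) ≠ 0 := by
      exact Complex.ofReal_ne_zero.2 (Real.sqrt_pos.2 hpx).ne'
    have ey : ((√(1 + (y : E3) 2) : ℝ) : ℂ) ≠ 0 := by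
      exact Complex.ofReal_ne_zero.2 (Real.sqrt_pos.2 hpy).ne'
    unfold uu vv
    rw [if_neg hx, if_neg hy]
    simp only [map_div₀, Complex.conj_ofReal, map_add, map_mul, Complex.conj_I]
    field_simp
    push_cast
    linear_combination (-2 * ((x : E3) 1 : ℂ) * ((y : E3) 1 : ℂ)) * Complex.I_sq
  rw [dist_sq']
  simp only [map_sub, map_mul]
  have e1 := uu_sq x
  have e2 := uu_sq y
  have e3 := vv_sq x
  have e4 := vv_sq y
  push_cast at *
  linear_combination (vv y * conj (vv y)) * e1 + (1 + ((x : E3) 2 : ℂ)) * e4 + (vv x * conj (vv x)) * e2 + (1 + ((y : E3) 2 : ℂ)) * e3 - key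

def DD {N : ℕ} (x : Fin N → S2) : ℝ := ∏ p ∈ Finset.univ.offDiag, dist (x p.1) (x p.2)

def ph {N : ℕ} (k : Fin N) (x : S2) : ℂ := vv x ^ (k : ℕ) * uu x ^ (k.rev : ℕ)

lemma ph_meas {N : ℕ} (k : Fin N) : Measurable (ph k) := by
  unfold ph
  exact (vv_meas.pow_const _).mul (uu_meas.pow_const _)

lemma DD_det {N : ℕ} (x : Fin N → S2) :
    (DD x : ℂ) = (Matrix.of fun i j => ph j (x i)).det * conj (Matrix.of fun i j => ph j (x i)).det := by
  have h1 : (Matrix.of fun i j => ph j (x i)) = Matrix.projVandermonde (fun i => vv (x i)) (fun i => uu (x i)) := by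
    ext i j; rw [Matrix.projVandermonde_apply]; rfl
  rw [h1, Matrix.det_projVandermonde]
  simp only [map_prod]
  rw [← Finset.prod_mul_distrib]
  simp_rw [← Finset.prod_mul_distrib, uv_dist]
  have h2 : DD x = ∏ i, ∏ j ∈ Finset.Ioi i, dist (x i) (x j) ^ 2 := by
    have := Finset.prod_prod_Ioi_mul_eq_prod_prod_off_diag (fun i j => dist (x i) (x j))
    have e : ∀ i j, dist (x j) (x i) * dist (x i) (x j) = dist (x i) (x j) ^ 2 := fun i j => by
      rw [dist_comm, pow_two]
    simp_rw [e] at this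
    have e2 : (Finset.univ.offDiag : Finset (Fin N × Fin N)) = Finset.univ.filter fun p => p.1 ≠ p.2 := by
      ext p; simp
    rw [this, DD, e2, Finset.prod_filter, Fintype.prod_prod_type_right]
    refine Finset.prod_congr rfl fun i _ => ?_
    rw [← Finset.prod_filter]
    refine Finset.prod_congr ?_ fun _ _ => rfl
    ext j; simp
  rw [h2]; push_cast; rfl

lemma ph_conj {N : ℕ} (k : Fin N) (x : S2) : ph k x * conj (ph k x) =
    (((1 - (x : E3) 2) ^ (k : ℕ) * (1 + (x : E3) 2) ^ (k.rev : ℕ) : ℝ) : ℂ) := by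
  unfold ph
  rw [map_mul, map_pow, map_pow, mul_mul_mul_comm, ← mul_pow, ← mul_pow, uu_sq, vv_sq]
  push_cast; rfl

lemma ph_bd {N : ℕ} (k : Fin N) (x : S2) : ‖ph k x‖ ≤ 2 ^ (k : ℕ) * 2 ^ (k.rev : ℕ) := by
  have h1 : ‖uu x‖ ≤ 2 := by
    have := congrArg norm (uu_sq x)
    rw [norm_mul, RCLike.norm_conj, Complex.norm_real, Real.norm_of_nonneg (one_add_nonneg x)] at this
    have := (coord_mem x).2
    nlinarith [norm_nonneg (uu x)]
  have h2 : ‖vv x‖ ≤ 2 := by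
    have := congrArg norm (vv_sq x)
    rw [norm_mul, RCLike.norm_conj, Complex.norm_real, Real.norm_of_nonneg (by linarith [(coord_mem x).2])] at this
    have := (coord_mem x).1
    nlinarith [norm_nonneg (vv x)]
  unfold ph
  rw [norm_mul, norm_pow, norm_pow]
  gcongr

lemma ph_int {N : ℕ} (k l : Fin N) {w : ℝ → ℝ} (hw : Continuous w) :
    Integrable (fun x : S2 => ph k x * conj (ph l x) * (w ((x : E3) 2) : ℝ)) sphereUniform := by
  have i1 : Integrable (fun x : S2 => ((w ((x : E3) 2) : ℝ) : ℂ)) sphereUniform := integrable_sph (by fun_prop)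
  refine i1.bdd_mul (c := (2 ^ (k : ℕ) * 2 ^ (k.rev : ℕ)) * (2 ^ (l : ℕ) * 2 ^ (l.rev : ℕ)))  ?_ (Filter.Eventually.of_forall fun x => ?_)
  · exact ((ph_meas k).mul (Complex.continuous_conj.measurable.comp (ph_meas l))).aestronglyMeasurable
  · rw [norm_mul, RCLike.norm_conj]
    have := ph_bd k x
    have := ph_bd l x
    gcongr

lemma vv_rot (a : ℝ) (x : S2) (h : (x : E3) 2 ≠ -1) :
    vv (rotS (axRot a) x) = Complex.exp (a * Complex.I) * vv x := by
  have h2 : (rotS (axRot a) x : E3) 2 = (x : E3) 2 := by simp [axRot_apply]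
  unfold vv
  rw [h2, if_neg h, if_neg h, ← mul_div_assoc]
  congr 1
  rw [Complex.exp_mul_I]
  simp [axRot_apply]
  linear_combination (-Complex.sin a * ((x : E3) 1 : ℂ)) * Complex.I_sq

lemma uu_rot (a : ℝ) (x : S2) : uu (rotS (axRot a) x) = uu x := by
  simp [uu, axRot_apply]

lemma ph_orth {N : ℕ} {k l : Fin N} (hkl : k ≠ l) {w : ℝ → ℝ} (hw : Continuous w) :
    ∫ x : S2, ph k x * conj (ph l x) * (w ((x : E3) 2) : ℝ) ∂sphereUniform = 0 := by
  have hne : ((k : ℕ) : ℝ) - (l : ℕ) ≠ 0 := by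
    intro e; apply hkl; ext; exact_mod_cast sub_eq_zero.1 e
  set a : ℝ := π / (((k : ℕ) : ℝ) - (l : ℕ)) with ha
  have hr := integral_rotS (axRot a) (ph_int k l hw).aestronglyMeasurable
  have e : ∀ x : S2, ph k (rotS (axRot a) x) * conj (ph l (rotS (axRot a) x)) * (w (((rotS (axRot a) x : S2) : E3) 2) : ℝ) =
      - (ph k x * conj (ph l x) * (w ((x : E3) 2) : ℝ)) := by
    intro x
    have h2 : (rotS (axRot a) x : E3) 2 = (x : E3) 2 := by simp [axRot_apply]
    rw [h2]
    by_cases h : (x : E3) 2 = -1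
    · have hu : uu x = 0 := by simp [uu, h]
      have : (k.rev : ℕ) ≠ 0 ∨ (l.rev : ℕ) ≠ 0 := by
        have h1 := k.2; have h2 := l.2
        have h3 : (k : ℕ) ≠ l := fun e => hkl (Fin.ext e)
        simp only [Fin.val_rev]; omega
      unfold ph
      rw [uu_rot, hu]
      rcases this with h | h <;> simp only [map_mul, map_pow, map_zero, zero_pow h] <;> ring
    · unfold ph
      rw [uu_rot, vv_rot a x h]
      simp only [map_mul, map_pow, mul_pow]
      have : Complex.exp (a * Complex.I) ^ (k : ℕ) * conj (Complex.exp (a * Complex.I)) ^ (l : ℕ) = -1 := by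
        rw [← Complex.exp_conj, ← Complex.exp_nat_mul, ← Complex.exp_nat_mul, ← Complex.exp_add, ← Complex.exp_pi_mul_I]
        congr 1
        simp only [map_mul, Complex.conj_ofReal, Complex.conj_I]
        have : (a : ℂ) * ((k : ℕ) - (l : ℕ)) = π := by
          have : a * (((k : ℕ) : ℝ) - (l : ℕ)) = π := by rw [ha]; field_simp
          exact_mod_cast this
        linear_combination Complex.I * this
      linear_combination (vv x ^ (k:ℕ) * uu x ^ (k.rev : ℕ) * (conj (vv x) ^ (l:ℕ) * conj (uu x) ^ (l.rev : ℕ)) * (w ((x : E3) 2) : ℝ)) * this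
  simp_rw [e] at hr
  rw [integral_neg] at hr
  exact self_eq_neg.1 hr.symm

lemma DD_nonneg {N : ℕ} (x : Fin N → S2) : 0 ≤ DD x := Finset.prod_nonneg fun _ _ => dist_nonneg

lemma DD_cont {N : ℕ} : Continuous (DD : (Fin N → S2) → ℝ) := by
  unfold DD; fun_prop

def cc (N k : ℕ) (w : ℝ → ℝ) : ℝ := ∫ x : S2, (1 - (x : E3) 2) ^ k * (1 + (x : E3) 2) ^ (N - 1 - k) * w ((x : E3) 2) ∂sphereUniform

lemma ph_same {N : ℕ} (k : Fin N) (w : ℝ → ℝ) :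
    ∫ x : S2, ph k x * conj (ph k x) * (w ((x : E3) 2) : ℝ) ∂sphereUniform = (cc N k w : ℂ) := by
  unfold cc
  rw [← integral_complex_ofReal]
  congr 1; ext x
  rw [ph_conj, Fin.val_rev]
  have : N - (k + 1 : ℕ) = N - 1 - k := by omega
  rw [this]; push_cast; rfl

lemma andreief {N : ℕ} {w : ℝ → ℝ} (hw : Continuous w) :
    ∫ x : Fin N → S2, DD x * ∏ i, w ((x i : E3) 2) ∂(Measure.pi fun _ => sphereUniform) =
      N.factorial * ∏ k ∈ Finset.range N, cc N k w := by
  have hC : ∫ x : Fin N → S2, ((DD x * ∏ i, w ((x i : E3) 2) : ℝ) : ℂ) ∂(Measure.pi fun _ => sphereUniform) =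
      ((N.factorial * ∏ k ∈ Finset.range N, cc N k w : ℝ) : ℂ) := by
    have e : ∀ x : Fin N → S2, ((DD x * ∏ i, w ((x i : E3) 2) : ℝ) : ℂ) =
        ∑ s : Equiv.Perm (Fin N), ∑ t : Equiv.Perm (Fin N), ((Equiv.Perm.sign s : ℤ) : ℂ) * ((Equiv.Perm.sign t : ℤ) : ℂ) *
          ∏ i, (ph (s i) (x i) * conj (ph (t i) (x i)) * (w ((x i : E3) 2) : ℝ)) := by
      intro x
      push_cast
      rw [DD_det, ← Matrix.det_transpose, Matrix.det_apply', map_sum, Finset.sum_mul_sum, Finset.sum_mul]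
      refine Finset.sum_congr rfl fun s _ => ?_
      rw [Finset.sum_mul]
      refine Finset.sum_congr rfl fun t _ => ?_
      simp only [Matrix.transpose_apply, Matrix.of_apply, map_mul, map_prod, Finset.prod_mul_distrib, map_intCast]
      ring
    have ii : ∀ s t : Equiv.Perm (Fin N), Integrable (fun x : Fin N → S2 => ((Equiv.Perm.sign s : ℤ) : ℂ) * ((Equiv.Perm.sign t : ℤ) : ℂ) *
          ∏ i, (ph (s i) (x i) * conj (ph (t i) (x i)) * (w ((x i : E3) 2) : ℝ))) (Measure.pi fun _ => sphereUniform) := by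
      intro s t
      refine Integrable.const_mul ?_ _
      exact Integrable.fintype_prod (f := fun i (y : S2) => ph (s i) y * conj (ph (t i) y) * ((w ((y : E3) 2) : ℝ) : ℂ)) fun i => ph_int (s i) (t i) hw
    simp_rw [e]
    rw [integral_finsetSum _ fun s _ => integrable_finsetSum _ fun t _ => ii s t]
    have e3 : ∀ s : Equiv.Perm (Fin N), ∫ x : Fin N → S2, ∑ t : Equiv.Perm (Fin N), ((Equiv.Perm.sign s : ℤ) : ℂ) * ((Equiv.Perm.sign t : ℤ) : ℂ) *
          ∏ i, (ph (s i) (x i) * conj (ph (t i) (x i)) * (w ((x i : E3) 2) : ℝ)) ∂(Measure.pi fun _ => sphereUniform) =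
          ∏ k : Fin N, (cc N k w : ℂ) := by
      intro s
      rw [integral_finsetSum _ fun t _ => ii s t]
      have e4 : ∀ t : Equiv.Perm (Fin N), ∫ x : Fin N → S2, ((Equiv.Perm.sign s : ℤ) : ℂ) * ((Equiv.Perm.sign t : ℤ) : ℂ) *
          ∏ i, (ph (s i) (x i) * conj (ph (t i) (x i)) * (w ((x i : E3) 2) : ℝ)) ∂(Measure.pi fun _ => sphereUniform) =
          if t = s then ∏ k : Fin N, (cc N k w : ℂ) else 0 := by
        intro t
        rw [integral_const_mul, integral_fintype_prod_eq_prod (fun i (y : S2) => ph (s i) y * conj (ph (t i) y) * ((w ((y : E3) 2) : ℝ) : ℂ))]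
        split_ifs with h
        · subst h
          simp_rw [ph_same]
          rw [Equiv.prod_comp t (fun k : Fin N => (cc N k w : ℂ)), ← Int.cast_mul, ← Units.val_mul, Int.units_mul_self]
          simp
        · obtain ⟨i, hi⟩ : ∃ i, t i ≠ s i := by
            by_contra hc; push Not at hc; exact h (Equiv.ext hc)
          rw [Finset.prod_eq_zero (Finset.mem_univ i) (ph_orth (Ne.symm hi) hw), mul_zero]
      simp_rw [e4]
      simp
    simp_rw [e3]
    simp [Fintype.card_perm, Finset.prod_range]
  rw [integral_complex_ofReal] at hC
  exact_mod_cast hC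

lemma cc_eq {N k : ℕ} (hk : k < N) {w : ℝ → ℝ} (hw : Continuous w) :
    cc N k w = 2 ^ (N - 1) * ∫ y in (0:ℝ)..1, w (1 - 2 * y) * bw k (N - 1 - k) y := by
  unfold cc
  rw [law_cont (g := fun t => (1 - t) ^ k * (1 + t) ^ (N - 1 - k) * w t) (by fun_prop)]
  have h := intervalIntegral.integral_comp_sub_mul (a := 0) (b := 1)
    (fun t => (1 - t) ^ k * (1 + t) ^ (N - 1 - k) * w t) (c := (2:ℝ)) (by norm_num) 1
  norm_num at h
  rw [← h, ← intervalIntegral.integral_const_mul]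
  refine intervalIntegral.integral_congr fun y _ => ?_
  simp only [bw]
  have : N - 1 = k + (N - 1 - k) := by omega
  nth_rw 2 [this]
  rw [pow_add, mul_pow, show (1 + (1 - 2 * y)) = 2 * (1 - y) by ring, mul_pow]
  ring

lemma cc_pos {N k : ℕ} (hk : k < N) {w : ℝ → ℝ} (hw : Continuous w) (hp : ∀ t, 0 < w t) : 0 < cc N k w := by
  rw [cc_eq hk hw]
  have := bw_int_pos k (N - 1 - k) (e := fun y => w (1 - 2 * y)) (by fun_prop) (fun _ => hp _)
  positivity

lemma DD_int_pos (N : ℕ) : 0 < ∫ x : Fin N → S2, DD x ∂(Measure.pi fun _ => sphereUniform) := by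
  have h := andreief (N := N) (w := fun _ => 1) continuous_const
  simp only [Finset.prod_const_one, mul_one] at h
  rw [h]
  have : 0 < ∏ k ∈ Finset.range N, cc N k fun _ => 1 :=
    Finset.prod_pos fun k hk => cc_pos (Finset.mem_range.1 hk) continuous_const fun _ => one_pos
  positivity

theorem kostlan {N : ℕ} (hN : 1 ≤ N) {h h' : ℝ → ℝ} (hd : ∀ x, HasDerivAt h (h' x) x) (hc : Continuous h') :
    ∫ x : Fin N → S2, DD x * rexp (∑ i, h ((x i : E3) 2)) ∂(Measure.pi fun _ => sphereUniform) ≤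
      (∫ x : Fin N → S2, DD x ∂(Measure.pi fun _ => sphereUniform)) *
        rexp (N / 2 * (∫ t in (-1:ℝ)..1, h t) + 1 / 2 * ∫ t in (-1:ℝ)..1, (1 - t ^ 2) * h' t ^ 2) := by
  have hcont : Continuous h := continuous_iff_continuousAt.2 fun x => (hd x).continuousAt
  have hw : Continuous fun t => rexp (h t) := by fun_prop
  have h0 := andreief (N := N) (w := fun _ => 1) continuous_const
  have h1 := andreief (N := N) hw
  simp only [Finset.prod_const_one, mul_one] at h0
  simp_rw [← Real.exp_sum] at h1
  rw [h0, h1, mul_assoc]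
  refine mul_le_mul_of_nonneg_left ?_ (by positivity)
  have p0 : ∀ k ∈ Finset.range N, 0 < cc N k fun _ => 1 := fun k hk =>
    cc_pos (Finset.mem_range.1 hk) continuous_const fun _ => one_pos
  have p1 : ∀ k ∈ Finset.range N, 0 < cc N k fun t => rexp (h t) := fun k hk =>
    cc_pos (Finset.mem_range.1 hk) hw fun _ => Real.exp_pos _
  rw [← div_le_iff₀' (Finset.prod_pos p0), ← Finset.prod_div_distrib]
  rw [← Real.exp_log (Finset.prod_pos fun k hk => div_pos (p1 k hk) (p0 k hk)), Real.exp_le_exp,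
    Real.log_prod fun k hk => (div_pos (p1 k hk) (p0 k hk)).ne']
  have hs := sum_log_bound (h := fun y => h (1 - 2 * y)) (h' := fun y => -2 * h' (1 - 2 * y)) N hN
    (fun x => by
      have := (hd (1 - 2 * x)).comp x ((((hasDerivAt_id x).const_mul 2).const_sub 1))
      refine this.congr_deriv ?_; ring) (by fun_prop)
  have e1 : ∀ k ∈ Finset.range N, Real.log ((cc N k fun t => rexp (h t)) / (cc N k fun _ => 1)) =
      Real.log ((∫ x in (0:ℝ)..1, rexp (h (1 - 2 * x)) * bw k (N - 1 - k) x) / ∫ x in (0:ℝ)..1, bw k (N - 1 - k) x) := by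
    intro k hk
    rw [cc_eq (Finset.mem_range.1 hk) hw, cc_eq (Finset.mem_range.1 hk) continuous_const,
      mul_div_mul_left _ _ (by positivity)]
    simp
  rw [Finset.sum_congr rfl e1]
  refine hs.trans (le_of_eq ?_)
  have k1 := intervalIntegral.integral_comp_sub_mul (a := 0) (b := 1) h (c := (2:ℝ)) (by norm_num) 1
  have k2 := intervalIntegral.integral_comp_sub_mul (a := 0) (b := 1) (fun t => (1 - t ^ 2) * h' t ^ 2) (c := (2:ℝ)) (by norm_num) 1
  rw [smul_eq_mul, show (1:ℝ) - 2 * 1 = -1 by norm_num, show (1:ℝ) - 2 * 0 = 1 by norm_num] at k1 k2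
  rw [k1]
  have k3 : ∫ x in (0:ℝ)..1, x * (1 - x) * (-2 * h' (1 - 2 * x)) ^ 2 = ∫ x in (0:ℝ)..1, (1 - (1 - 2 * x) ^ 2) * h' (1 - 2 * x) ^ 2 :=
    intervalIntegral.integral_congr fun x _ => by ring
  rw [k3, k2]; ring

end
end

section
open MeasureTheory Real Polynomial
open scoped ENNReal RealInnerProductSpace

noncomputable section

def bb (l : ℕ) : ℝ := (2 * ((l + 1 : ℕ) : ℝ) + 1) / (√(4 * π) * lam l)

def aa (l : ℕ) : ℝ := (2 * ((l + 1 : ℕ) : ℝ) + 1) / (2 * π * lam l)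

lemma bb_sq (l : ℕ) : bb l ^ 2 = (2 * ((l + 1 : ℕ) : ℝ) + 1) ^ 2 / (4 * π) / lam l ^ 2 := by
  unfold bb
  rw [div_pow, mul_pow, Real.sq_sqrt (by positivity), div_div]

def qq {N : ℕ} (x : Fin N → S2) (z : S2) : ℝ := ∑ l : Fin N, (bb l * ∑ i, PP (l + 1) (x i) z) ^ 2

lemma YY_eq {N : ℕ} (x : Fin N → S2) : YY x = ∫ z, qq x z ∂sphereUniform := by
  unfold YY qq
  rw [integral_finsetSum _ fun l _ => integrable_sph (by fun_prop), Finset.sum_range]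
  refine Finset.sum_congr rfl fun l _ => ?_
  simp_rw [mul_pow]
  rw [integral_const_mul, SS_eq, bb_sq]; ring

lemma qq_cont {N : ℕ} : Continuous fun p : (Fin N → S2) × S2 => qq p.1 p.2 := by
  unfold qq; fun_prop

lemma qq_cont2 {N : ℕ} (x : Fin N → S2) : Continuous fun z : S2 => qq x z := by
  unfold qq; fun_prop

lemma YY_cont {N : ℕ} : Continuous (YY : (Fin N → S2) → ℝ) := by
  unfold YY SS
  simp_rw [zonal_eq]
  fun_prop

lemma exp_YY_le {N : ℕ} (x : Fin N → S2) : rexp (YY x) ≤ ∫ z, rexp (qq x z) ∂sphereUniform := by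
  have hc : Continuous fun z => qq x z := qq_cont2 x
  rw [YY_eq]
  exact convexOn_exp.map_integral_le Real.continuous_exp.continuousOn isClosed_univ (by simp)
    (integrable_sph hc) (integrable_sph (by fun_prop))

abbrev MU (N : ℕ) : Measure (Fin N → S2) := Measure.pi fun _ : Fin N => sphereUniform

lemma rot_inv {N : ℕ} (g : E3 ≃ₗᵢ[ℝ] E3) {F : (Fin N → S2) → ℝ≥0∞} (hF : Measurable F) :
    ∫⁻ x, F (fun i => rotS g (x i)) ∂(MU N) = ∫⁻ x, F x ∂(MU N) :=
  (measurePreserving_pi (fun _ : Fin N => sphereUniform) (fun _ => sphereUniform)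
    (fun _ => mp_rotS g)).lintegral_comp hF

lemma step1 {N : ℕ} : ∫⁻ x, ENNReal.ofReal (DD x) * ENNReal.ofReal (rexp (YY x)) ∂(MU N) ≤
    ∫⁻ x, ENNReal.ofReal (DD x) * ENNReal.ofReal (rexp (qq x pole)) ∂(MU N) := by
  have hD : Continuous (DD : (Fin N → S2) → ℝ) := DD_cont
  have hq : Continuous fun p : (Fin N → S2) × S2 => qq p.1 p.2 := qq_cont
  have hm : Measurable fun p : (Fin N → S2) × S2 => ENNReal.ofReal (DD p.1) * ENNReal.ofReal (rexp (qq p.1 p.2)) := by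
    have h1 : Continuous fun p : (Fin N → S2) × S2 => DD p.1 := by fun_prop
    have h2 : Continuous fun p : (Fin N → S2) × S2 => rexp (qq p.1 p.2) := by fun_prop
    exact h1.measurable.ennreal_ofReal.mul h2.measurable.ennreal_ofReal
  calc ∫⁻ x, ENNReal.ofReal (DD x) * ENNReal.ofReal (rexp (YY x)) ∂(MU N)
      ≤ ∫⁻ x, ∫⁻ z, ENNReal.ofReal (DD x) * ENNReal.ofReal (rexp (qq x z)) ∂sphereUniform ∂(MU N) := by
        refine lintegral_mono fun x => ?_
        have hc : Continuous fun z => rexp (qq x z) := Real.continuous_exp.comp (qq_cont2 x)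
        rw [lintegral_const_mul _ hc.measurable.ennreal_ofReal]
        rw [← ofReal_integral_eq_lintegral_ofReal (integrable_sph hc) (Filter.Eventually.of_forall fun _ => (Real.exp_pos _).le)]
        gcongr
        exact exp_YY_le x
    _ = ∫⁻ z, ∫⁻ x, ENNReal.ofReal (DD x) * ENNReal.ofReal (rexp (qq x z)) ∂(MU N) ∂sphereUniform :=
        lintegral_lintegral_swap hm.aemeasurable
    _ = ∫⁻ z, ∫⁻ x, ENNReal.ofReal (DD x) * ENNReal.ofReal (rexp (qq x pole)) ∂(MU N) ∂sphereUniform := by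
        refine lintegral_congr fun z => ?_
        obtain ⟨g, hg⟩ := exists_rot pole z
        have hz : Continuous fun x : Fin N → S2 => qq x z := by unfold qq; fun_prop
        have hm2 : Measurable fun x : Fin N → S2 => ENNReal.ofReal (DD x) * ENNReal.ofReal (rexp (qq x z)) := by
          have h2 : Continuous fun x : Fin N → S2 => rexp (qq x z) := by fun_prop
          exact hD.measurable.ennreal_ofReal.mul h2.measurable.ennreal_ofReal
        rw [← rot_inv g hm2]
        refine lintegral_congr fun x => ?_
        have h1 : DD (fun i => rotS g (x i)) = DD x := by
          unfold DD
          refine Finset.prod_congr rfl fun p _ => ?_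
          rw [Subtype.dist_eq, Subtype.dist_eq]; simp
        have h2 : qq (fun i => rotS g (x i)) z = qq x pole := by
          unfold qq
          have : ∀ l y, PP l (rotS g y) z = PP l y pole := fun l y => by
            rw [← hg]; unfold PP; simp
          simp_rw [this]
        rw [h1, h2]
    _ = _ := by simp

open ProbabilityTheory

abbrev GA (N : ℕ) : Measure (Fin N → ℝ) := Measure.pi fun _ : Fin N => gaussianReal 0 1

lemma gauss_lin {N : ℕ} (c : Fin N → ℝ) :
    ENNReal.ofReal (rexp (∑ l, c l ^ 2)) = ∫⁻ ξ, ENNReal.ofReal (rexp (∑ l, √2 * c l * ξ l)) ∂(GA N) := by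
  simp_rw [Real.exp_sum]
  rw [← ofReal_integral_eq_lintegral_ofReal
    (Integrable.fintype_prod (f := fun l (y : ℝ) => rexp (√2 * c l * y)) fun l => integrable_exp_mul_gaussianReal _)
    (Filter.Eventually.of_forall fun _ => by positivity)]
  rw [integral_fintype_prod_eq_prod fun l (y : ℝ) => rexp (√2 * c l * y)]
  congr 1
  refine Finset.prod_congr rfl fun l _ => ?_
  have := congrFun (mgf_id_gaussianReal (μ := 0) (v := 1)) (√2 * c l)
  simp only [mgf, id] at this
  rw [this]
  congr 1
  rw [mul_pow, Real.sq_sqrt (by norm_num)]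
  simp

lemma gauss_sq_int {a : ℝ} (h : a < 1 / 2) : Integrable (fun y => rexp (a * y ^ 2)) (gaussianReal 0 1) := by
  rw [gaussianReal_of_var_ne_zero 0 one_ne_zero]
  rw [integrable_withDensity_iff_integrable_smul' (measurable_gaussianPDF 0 1) (by simp [gaussianPDF])]
  have := (integrable_exp_neg_mul_sq (b := 1 / 2 - a) (by linarith)).const_mul ((√(2 * π))⁻¹)
  refine this.congr (Filter.Eventually.of_forall fun y => ?_)
  simp only [toReal_gaussianPDF, gaussianPDFReal, smul_eq_mul, NNReal.coe_one, mul_one, sub_zero]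
  rw [mul_assoc, ← Real.exp_add]
  congr 2; ring

lemma gauss_sq {a : ℝ} (h0 : 0 ≤ a) (h : a ≤ 1 / 4) : ∫ y, rexp (a * y ^ 2) ∂(gaussianReal 0 1) ≤ rexp (2 * a) := by
  rw [integral_gaussianReal_eq_integral_smul one_ne_zero]
  have e : ∀ y : ℝ, gaussianPDFReal 0 1 y • rexp (a * y ^ 2) = (√(2 * π))⁻¹ * rexp (-(1 / 2 - a) * y ^ 2) := by
    intro y
    simp only [gaussianPDFReal, smul_eq_mul, NNReal.coe_one, mul_one, sub_zero]
    rw [mul_assoc, ← Real.exp_add]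
    congr 2; ring
  simp_rw [e]
  rw [integral_const_mul, integral_gaussian, ← Real.sqrt_inv, ← Real.sqrt_mul (by positivity)]
  apply Real.sqrt_le_iff.2 ⟨by positivity, ?_⟩
  rw [← Real.exp_nat_mul]
  have h1 : (2 * π)⁻¹ * (π / (1 / 2 - a)) = (1 - 2 * a)⁻¹ := by
    have : 1 / 2 - a ≠ 0 := by linarith
    have : 1 - 2 * a ≠ 0 := by linarith
    field_simp
  rw [h1]
  have h2 := Real.add_one_le_exp (4 * a)
  push_cast
  rw [show (2:ℝ) * (2 * a) = 4 * a by ring]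
  refine le_trans ?_ h2
  rw [inv_le_iff_one_le_mul₀ (by linarith)]
  nlinarith

def HH {N : ℕ} (ξ : Fin N → ℝ) : ℝ[X] := ∑ l : Fin N, C (√2 * bb l * ξ l) * legendreP (l + 1)

lemma HH_int {N : ℕ} (ξ : Fin N → ℝ) : ∫ t in (-1:ℝ)..1, (HH ξ).eval t = 0 := by
  rw [← Lint_apply, HH, map_sum]
  refine Finset.sum_eq_zero fun l _ => ?_
  rw [Lint_C_mul]
  have := leg_orth (l := (l:ℕ) + 1) (q := 1) (by rw [degree_one]; exact_mod_cast Nat.succ_pos _)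
  rw [mul_one] at this
  rw [this, mul_zero]

lemma HH_energy {N : ℕ} (ξ : Fin N → ℝ) : 1 / 2 * ∫ t in (-1:ℝ)..1, (1 - t ^ 2) * (derivative (HH ξ)).eval t ^ 2 =
    ∑ l : Fin N, aa l * ξ l ^ 2 := by
  have e : ∫ t in (-1:ℝ)..1, (1 - t ^ 2) * (derivative (HH ξ)).eval t ^ 2 =
      Lint ((1 - X ^ 2) * derivative (HH ξ) * derivative (HH ξ)) := by
    rw [Lint_apply]
    refine intervalIntegral.integral_congr fun t _ => ?_
    simp; ring
  rw [e, HH, derivative_sum, mul_assoc, Finset.sum_mul_sum, Finset.mul_sum, map_sum, Finset.mul_sum]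
  refine Finset.sum_congr rfl fun l _ => ?_
  rw [Finset.mul_sum, map_sum]
  simp_rw [← mul_assoc (1 - X ^ 2 : ℝ[X])]
  have e2 : ∀ m : Fin N, Lint ((1 - X ^ 2) * derivative (C (√2 * bb l * ξ l) * legendreP (l + 1)) * derivative (C (√2 * bb m * ξ m) * legendreP (m + 1))) =
      if m = l then (√2 * bb l * ξ l) * (√2 * bb m * ξ m) * (((l + 1 : ℕ) : ℝ) * (((l + 1 : ℕ) : ℝ) + 1) * (2 / (2 * ((l + 1 : ℕ) : ℝ) + 1))) else 0 := by
    intro m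
    rw [derivative_C_mul, derivative_C_mul]
    rw [show (1 - X ^ 2) * (C (√2 * bb l * ξ l) * derivative (legendreP (l + 1))) * (C (√2 * bb m * ξ m) * derivative (legendreP (m + 1))) =
      C (√2 * bb l * ξ l) * (C (√2 * bb m * ξ m) * ((1 - X ^ 2) * derivative (legendreP (l + 1)) * derivative (legendreP (m + 1)))) by ring]
    rw [Lint_C_mul, Lint_C_mul, leg_energy]
    by_cases h : m = l
    · subst h; rw [if_pos rfl, if_pos rfl]; ring
    · have : ¬ ((l : ℕ) + 1 = m + 1) := fun e => h (Fin.ext (by omega))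
      rw [if_neg h, if_neg this]; simp
  simp_rw [e2]
  rw [Finset.sum_ite_eq' Finset.univ l, if_pos (Finset.mem_univ l)]
  have h2 : √2 * √2 = 2 := Real.mul_self_sqrt (by norm_num)
  have hb := bb_sq l
  have hl : lam l ≠ 0 := (lam_pos l).ne'
  have hl2 : ((l + 1 : ℕ) : ℝ) * (((l + 1 : ℕ) : ℝ) + 1) = lam l := by unfold lam; push_cast; ring
  rw [hl2]
  have h3 : (2 * ((l + 1 : ℕ) : ℝ) + 1) ≠ 0 := by positivity
  calc _ = (√2 * √2) * bb l ^ 2 * ξ l ^ 2 * lam l / (2 * ((l + 1 : ℕ) : ℝ) + 1) := by ring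
    _ = _ := by
      rw [h2, hb]; unfold aa
      have := Real.pi_pos.ne'
      field_simp
      ring

lemma aa_nonneg (l : ℕ) : 0 ≤ aa l := by
  have := lam_pos l
  unfold aa; positivity

lemma aa_le (l : ℕ) : aa l ≤ 1 / 4 := by
  have := lam_pos l
  unfold aa
  rw [div_le_iff₀ (by positivity)]
  have hp := Real.pi_gt_three
  have : (3:ℝ) * lam l ≤ π * lam l := by nlinarith
  unfold lam at *
  have h0 : (0:ℝ) ≤ l := Nat.cast_nonneg l
  push_cast
  nlinarith

lemma aa_le2 (l : ℕ) : 2 * aa l ≤ 1 / ((l:ℝ) + 1) := by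
  have := lam_pos l
  unfold aa
  rw [← mul_div_assoc, div_le_div_iff₀ (by positivity) (by positivity)]
  have hp := Real.pi_gt_three
  have : (3:ℝ) * lam l ≤ π * lam l := by nlinarith
  unfold lam at *
  have h0 : (0:ℝ) ≤ l := Nat.cast_nonneg l
  push_cast
  nlinarith

lemma aa_sum (N : ℕ) : ∑ l : Fin N, 2 * aa l ≤ 1 + Real.log N := by
  have h := harmonic_le_one_add_log N
  refine le_trans ?_ h
  rw [harmonic, ← Finset.sum_range (fun l => 2 * aa l)]
  push_cast
  exact Finset.sum_le_sum fun l _ => by simpa using aa_le2 l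

lemma gauss_final (N : ℕ) : ∫⁻ ξ, ENNReal.ofReal (rexp (∑ l : Fin N, aa l * ξ l ^ 2)) ∂(GA N) ≤
    ENNReal.ofReal (rexp (1 + Real.log N)) := by
  simp_rw [Real.exp_sum]
  have hlt : ∀ l, aa l < 1 / 2 := fun l => by linarith [aa_le l]
  rw [← ofReal_integral_eq_lintegral_ofReal
    (Integrable.fintype_prod (f := fun (l : Fin N) (y : ℝ) => rexp (aa l * y ^ 2)) fun l => gauss_sq_int (hlt l))
    (Filter.Eventually.of_forall fun _ => by positivity)]
  rw [integral_fintype_prod_eq_prod fun (l : Fin N) (y : ℝ) => rexp (aa l * y ^ 2)]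
  refine ENNReal.ofReal_le_ofReal ?_
  refine le_trans (Finset.prod_le_prod (fun l _ => integral_nonneg fun y => (Real.exp_pos _).le)
    fun l _ => gauss_sq (aa_nonneg l) (aa_le l)) ?_
  rw [← Real.exp_sum, Real.exp_le_exp]
  exact aa_sum N

lemma pi_int {N : ℕ} {f : (Fin N → S2) → ℝ} (hf : Continuous f) : Integrable f (MU N) :=
  hf.integrable_of_hasCompactSupport (HasCompactSupport.of_compactSpace f)

lemma kost_HH {N : ℕ} (hN : 1 ≤ N) (ξ : Fin N → ℝ) :
    ∫⁻ x, ENNReal.ofReal (DD x) * ENNReal.ofReal (rexp (∑ i, (HH ξ).eval ((x i : E3) 2))) ∂(MU N) ≤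
      ENNReal.ofReal (∫ x, DD x ∂(MU N)) * ENNReal.ofReal (rexp (∑ l : Fin N, aa l * ξ l ^ 2)) := by
  have hD : Continuous (DD : (Fin N → S2) → ℝ) := DD_cont
  have hk := kostlan hN (h := fun t => (HH ξ).eval t) (h' := fun t => (derivative (HH ξ)).eval t)
    (fun t => (HH ξ).hasDerivAt t) (by fun_prop)
  rw [HH_int, HH_energy, mul_zero, zero_add] at hk
  simp_rw [← ENNReal.ofReal_mul (DD_nonneg _)]
  rw [← ENNReal.ofReal_mul (integral_nonneg fun _ => DD_nonneg _)]
  rw [← ofReal_integral_eq_lintegral_ofReal (pi_int (by fun_prop))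
    (Filter.Eventually.of_forall fun x => mul_nonneg (DD_nonneg x) (Real.exp_pos _).le)]
  exact ENNReal.ofReal_le_ofReal hk

lemma qq_pole {N : ℕ} (x : Fin N → S2) : ENNReal.ofReal (rexp (qq x pole)) =
    ∫⁻ ξ, ENNReal.ofReal (rexp (∑ i, (HH ξ).eval ((x i : E3) 2))) ∂(GA N) := by
  unfold qq
  rw [gauss_lin]
  refine lintegral_congr fun ξ => ?_
  congr 2
  simp only [HH, eval_finsetSum, eval_mul, eval_C]
  rw [Finset.sum_comm]
  refine Finset.sum_congr rfl fun l _ => ?_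
  rw [← Finset.mul_sum]
  have : ∀ y : S2, PP (l + 1) y pole = (legendreP (l + 1)).eval ((y : E3) 2) := fun y => by
    rw [PP_symm, PP, inner_pole]
  simp_rw [this]; ring

theorem main_mgf {N : ℕ} (hN : 1 ≤ N) :
    ∫⁻ x, ENNReal.ofReal (DD x) * ENNReal.ofReal (rexp (YY x)) ∂(MU N) ≤
      ENNReal.ofReal (∫ x, DD x ∂(MU N)) * ENNReal.ofReal (rexp (1 + Real.log N)) := by
  refine step1.trans ?_
  have hD : Continuous (DD : (Fin N → S2) → ℝ) := DD_cont
  have hc : Continuous fun p : (Fin N → S2) × (Fin N → ℝ) => rexp (∑ i, (HH p.2).eval ((p.1 i : E3) 2)) := by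
    simp only [HH, eval_finsetSum, eval_mul, eval_C]
    fun_prop
  have hm : Measurable fun p : (Fin N → S2) × (Fin N → ℝ) =>
      ENNReal.ofReal (DD p.1) * ENNReal.ofReal (rexp (∑ i, (HH p.2).eval ((p.1 i : E3) 2))) := by
    have h1 : Continuous fun p : (Fin N → S2) × (Fin N → ℝ) => DD p.1 := by fun_prop
    exact h1.measurable.ennreal_ofReal.mul hc.measurable.ennreal_ofReal
  calc _ = ∫⁻ x, ∫⁻ ξ, ENNReal.ofReal (DD x) * ENNReal.ofReal (rexp (∑ i, (HH ξ).eval ((x i : E3) 2))) ∂(GA N) ∂(MU N) := by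
        refine lintegral_congr fun x => ?_
        rw [qq_pole, lintegral_const_mul]
        exact (hc.measurable.comp measurable_prodMk_left).ennreal_ofReal
    _ = ∫⁻ ξ, ∫⁻ x, ENNReal.ofReal (DD x) * ENNReal.ofReal (rexp (∑ i, (HH ξ).eval ((x i : E3) 2))) ∂(MU N) ∂(GA N) :=
        lintegral_lintegral_swap hm.aemeasurable
    _ ≤ ∫⁻ ξ, ENNReal.ofReal (∫ x, DD x ∂(MU N)) * ENNReal.ofReal (rexp (∑ l : Fin N, aa l * ξ l ^ 2)) ∂(GA N) :=
        lintegral_mono fun ξ => kost_HH hN ξ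
    _ ≤ _ := by
        rw [lintegral_const_mul _ (by fun_prop)]
        gcongr
        exact gauss_final N

end
end

section
open MeasureTheory Real
open scoped ENNReal RealInnerProductSpace

noncomputable section

lemma tail_bound {N : ℕ} (hN : 1 ≤ N) (τ : ℝ) :
    sphericalEnsemble N {x | τ < YY x} ≤ ENNReal.ofReal (rexp (1 + Real.log N - τ)) := by
  have hD : Continuous (DD : (Fin N → S2) → ℝ) := DD_cont
  have hY : Continuous (YY : (Fin N → S2) → ℝ) := YY_cont
  have hA : MeasurableSet {x : Fin N → S2 | τ < YY x} := measurableSet_lt measurable_const hY.measurable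
  have hZ : ∫⁻ x, ensembleDensity N x ∂(MU N) = ENNReal.ofReal (∫ x, DD x ∂(MU N)) :=
    (ofReal_integral_eq_lintegral_ofReal (pi_int hD) (Filter.Eventually.of_forall DD_nonneg)).symm
  have hpos := DD_int_pos N
  rw [sphericalEnsemble, Measure.smul_apply, smul_eq_mul, hZ, withDensity_apply _ hA]
  have h1 : ∫⁻ x in {x : Fin N → S2 | τ < YY x}, ensembleDensity N x ∂(MU N) ≤
      ENNReal.ofReal (rexp (-τ)) * (ENNReal.ofReal (∫ x, DD x ∂(MU N)) * ENNReal.ofReal (rexp (1 + Real.log N))) := by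
    refine le_trans ?_ (mul_le_mul_right (main_mgf hN) (ENNReal.ofReal (rexp (-τ))))
    have hm : Measurable fun x : Fin N → S2 => ENNReal.ofReal (DD x) * ENNReal.ofReal (rexp (YY x)) := by
      have h2 : Continuous fun x : Fin N → S2 => rexp (YY x) := by fun_prop
      exact hD.measurable.ennreal_ofReal.mul h2.measurable.ennreal_ofReal
    rw [← lintegral_const_mul _ hm]
    refine le_trans (setLIntegral_mono (hm.const_mul _) fun x hx => ?_) (setLIntegral_le_lintegral _ _)
    change ENNReal.ofReal (DD x) ≤ _
    rw [← ENNReal.ofReal_mul (DD_nonneg x), ← ENNReal.ofReal_mul (Real.exp_pos _).le]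
    refine ENNReal.ofReal_le_ofReal ?_
    rw [mul_left_comm, ← Real.exp_add]
    have hx' : τ < YY x := hx
    have : 1 ≤ rexp (-τ + YY x) := Real.one_le_exp (by linarith)
    nlinarith [DD_nonneg x]
  refine (mul_le_mul_right h1 _).trans ?_
  rw [mul_left_comm, ← mul_assoc (ENNReal.ofReal (∫ x, DD x ∂(MU N)))⁻¹,
    ENNReal.inv_mul_cancel (by simpa using hpos) ENNReal.ofReal_ne_top, one_mul,
    ← ENNReal.ofReal_mul (Real.exp_pos _).le, ← Real.exp_add]
  exact ENNReal.ofReal_le_ofReal (by rw [Real.exp_le_exp]; linarith)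

lemma ens_univ (N : ℕ) : sphericalEnsemble N Set.univ = 1 := by
  have hD : Continuous (DD : (Fin N → S2) → ℝ) := DD_cont
  have hZ : ∫⁻ x, ensembleDensity N x ∂(MU N) = ENNReal.ofReal (∫ x, DD x ∂(MU N)) :=
    (ofReal_integral_eq_lintegral_ofReal (pi_int hD) (Filter.Eventually.of_forall DD_nonneg)).symm
  have hpos := DD_int_pos N
  rw [sphericalEnsemble, Measure.smul_apply, smul_eq_mul, withDensity_apply _ MeasurableSet.univ,
    Measure.restrict_univ, hZ]
  exact ENNReal.inv_mul_cancel (by simpa using hpos) ENNReal.ofReal_ne_top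

end
end

noncomputable section

/-- There exists a constant `C > 0` such that for every integer `N ≥ 2` and every
real `R` with `C ≤ R ≤ N/(log N)^{1/2}`, the spherical ensemble with `N` particles satisfies
`𝐏_N( wce(x_N; 2) ≤ R (log N)^{1/2} / N ) ≥ 1 − N^{−R²/C}`. -/
theorem spherical_ensemble_nearly_qmc_s_eq_two :
    ∃ C : ℝ, 0 < C ∧ ∀ N : ℕ, 2 ≤ N → ∀ R : ℝ,
      C ≤ R → R ≤ (N : ℝ) / Real.sqrt (Real.log N) →
      ENNReal.ofReal (1 - (N : ℝ) ^ (-(R ^ 2 / C))) ≤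
        sphericalEnsemble N
          {x | wce N 2 x ≤ R * Real.sqrt (Real.log N) / N} := by
  refine ⟨4, by norm_num, fun N hN R hR _ => ?_⟩
  have hN1 : 1 ≤ N := by omega
  have hN0 : (0:ℝ) < N := by exact_mod_cast hN1
  have hlog : 1 / 2 ≤ Real.log N := by
    have h1 : Real.log 2 ≤ Real.log N := Real.log_le_log (by norm_num) (by exact_mod_cast hN)
    linarith [Real.log_two_gt_d9]
  have hR2 : 16 ≤ R ^ 2 := by nlinarith
  set L := Real.log N with hL
  set τ : ℝ := R ^ 2 * L - 1 with hτ
  have hY : Continuous (YY : (Fin N → S2) → ℝ) := YY_cont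
  have hA : MeasurableSet {x : Fin N → S2 | τ < YY x} := measurableSet_lt measurable_const hY.measurable
  have hsub : {x : Fin N → S2 | τ < YY x}ᶜ ⊆ {x | wce N 2 x ≤ R * Real.sqrt L / N} := by
    intro x hx
    have hx' : YY x ≤ τ := not_lt.1 hx
    refine (wce_le_YY hN1 x).trans ?_
    gcongr
    refine Real.sqrt_le_iff.2 ⟨by positivity, ?_⟩
    rw [mul_pow, Real.sq_sqrt (by linarith)]
    linarith
  have ht := tail_bound hN1 τ
  have hb : rexp (1 + L - τ) ≤ (N : ℝ) ^ (-(R ^ 2 / 4)) := by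
    rw [Real.rpow_def_of_pos hN0, ← hL, Real.exp_le_exp]
    nlinarith
  have : IsProbabilityMeasure (sphericalEnsemble N) := ⟨ens_univ N⟩
  refine le_trans ?_ (measure_mono hsub)
  rw [prob_compl_eq_one_sub hA]
  rw [ENNReal.ofReal_sub _ (by positivity), ENNReal.ofReal_one]
  exact tsub_le_tsub_left (ht.trans (ENNReal.ofReal_le_ofReal hb)) 1

end
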